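/- arXiv:0711.0350 — 2 statements merged into one kernel-verified Lean document; each statement's English description precedes it below -/
import Mathlib

section
/- Let S be the binary odometer on [0,1), let r be uniform on [0,1), and set X_n = S^n r. Then {X_n} is a stationary ergodic Markov chain of order one, the conditional expectation satisfies E(X_{n+1} | X_0,…,X_n) = S(X_n), and the map x ↦ Sx is continuous at every point of [0,1) that is not a dyadic rational; hence the conditional expectation E(X_1 | X^0_{-∞}) is almost surely continuous but is not continuous on all of [0,1) (e.g. it cannot be made continuous at 0.5). -/
open MeasureTheory Set

noncomputable section

/-- The `i`-th binary digit of `r`. -/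
def binDigit (r : ℝ) (i : ℕ) : ℕ := ⌊r * 2 ^ i⌋.toNat % 2

/-- `τ(r) = min {i > 0 : r_i = 1}`. -/
def binTau (r : ℝ) : ℕ := sInf {i : ℕ | 0 < i ∧ binDigit r i = 1}

/-- The binary odometer, defined digitwise. -/
def odometer (r : ℝ) : ℝ :=
  ∑' i : ℕ,
    (if 0 < i ∧ i < binTau r then (1 : ℝ)
      else if i = binTau r then 0
      else (binDigit r i : ℝ)) * (2 : ℝ) ^ (-(i : ℤ))

/-- The uniform measure on `[0,1)`. -/
def unif : Measure ℝ := (volume : Measure ℝ).restrict (Ico 0 1)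

/-- A real number is a dyadic rational if it is of the form `a / 2^k`. -/
def IsDyadic (r : ℝ) : Prop := ∃ (a : ℤ) (k : ℕ), r = (a : ℝ) / 2 ^ k

open Filter Topology

lemma binDigit_eq (x : ℝ) (i : ℕ) : binDigit x i = ⌊x * 2 ^ i⌋₊ % 2 := by
  rw [binDigit, Int.floor_toNat]

lemma binDigit_le (x : ℝ) (i : ℕ) : (binDigit x i : ℝ) ≤ 1 := by
  have : binDigit x i ≤ 1 := by unfold binDigit; omega
  exact_mod_cast this

lemma zpow_half (i : ℕ) : (2 : ℝ) ^ (-(i : ℤ)) = (1 / 2) ^ i := by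
  simp [zpow_neg]

lemma floor_rec (x : ℝ) (n : ℕ) :
    ⌊x * 2 ^ (n + 1)⌋₊ = 2 * ⌊x * 2 ^ n⌋₊ + binDigit x (n + 1) := by
  have h := Nat.floor_div_natCast (x * 2 ^ (n + 1)) 2
  have e : x * 2 ^ (n + 1) / ((2 : ℕ) : ℝ) = x * 2 ^ n := by
    push_cast; rw [pow_succ]; ring
  rw [e] at h
  rw [binDigit_eq, h]
  omega

lemma hasSum_digits {x : ℝ} (h0 : 0 ≤ x) (h1 : x < 1) :
    HasSum (fun i : ℕ => (binDigit x i : ℝ) * (1 / 2) ^ i) x := by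
  rw [hasSum_iff_tendsto_nat_of_nonneg (fun i => by positivity)]
  rw [← tendsto_add_atTop_iff_nat 1]
  have key : ∀ n : ℕ, ∑ i ∈ Finset.range (n + 1), (binDigit x i : ℝ) * (1 / 2) ^ i
      = (⌊x * 2 ^ n⌋₊ : ℝ) / 2 ^ n := by
    intro n
    induction n with
    | zero =>
      have : ⌊x⌋₊ = 0 := Nat.floor_eq_zero.2 h1
      simp [binDigit_eq, this]
    | succ n ih =>
      rw [Finset.sum_range_succ, ih, floor_rec]
      push_cast
      rw [one_div, inv_pow]
      field_simp
      ring
  simp_rw [key]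
  exact (tendsto_nat_floor_mul_div_atTop h0).comp (tendsto_pow_atTop_atTop_of_one_lt one_lt_two)

lemma tau_eq {x : ℝ} {k : ℕ} (h1 : (1 / 2 : ℝ) ^ (k + 1) ≤ x) (h2 : x < (1 / 2 : ℝ) ^ k) :
    binTau x = k + 1 := by
  have hx : 0 < x := lt_of_lt_of_le (by positivity) h1
  have small : ∀ i ≤ k, binDigit x i = 0 := by
    intro i hi
    have : ⌊x * 2 ^ i⌋₊ = 0 := by
      rw [Nat.floor_eq_zero]
      calc x * 2 ^ i ≤ x * 2 ^ k := by gcongr; norm_num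
        _ < (1 / 2) ^ k * 2 ^ k := by gcongr
        _ = 1 := by rw [← mul_pow]; norm_num
    simp [binDigit_eq, this]
  have big : binDigit x (k + 1) = 1 := by
    have : ⌊x * 2 ^ (k + 1)⌋₊ = 1 := by
      rw [Nat.floor_eq_iff (by positivity)]
      constructor
      · calc ((1 : ℕ) : ℝ) = (1 / 2) ^ (k + 1) * 2 ^ (k + 1) := by rw [← mul_pow]; norm_num
          _ ≤ _ := by gcongr
      · calc x * 2 ^ (k + 1) < (1 / 2) ^ k * 2 ^ (k + 1) := by gcongr
          _ = 2 := by rw [pow_succ, ← mul_assoc, ← mul_pow]; norm_num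
          _ = _ := by norm_num
    simp [binDigit_eq, this]
  unfold binTau
  apply le_antisymm
  · exact Nat.sInf_le ⟨by omega, big⟩
  · have hne : {i : ℕ | 0 < i ∧ binDigit x i = 1}.Nonempty := ⟨k + 1, by omega, big⟩
    apply le_csInf hne
    rintro i ⟨_, hi⟩
    by_contra hlt
    have := small i (by omega)
    omega

lemma digit_zero {x : ℝ} {k : ℕ} (h1 : (1 / 2 : ℝ) ^ (k + 1) ≤ x) (h2 : x < (1 / 2 : ℝ) ^ k) :
    (∀ i ≤ k, binDigit x i = 0) ∧ binDigit x (k + 1) = 1 := by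
  have ht := tau_eq h1 h2
  have hx : 0 < x := lt_of_lt_of_le (by positivity) h1
  constructor
  · intro i hi
    rcases Nat.eq_zero_or_pos i with rfl | hpos
    · have : ⌊x⌋₊ = 0 := Nat.floor_eq_zero.2 (h2.trans_le (pow_le_one₀ (by norm_num) (by norm_num)))
      simp [binDigit_eq, this]
    · have : i ∉ {i : ℕ | 0 < i ∧ binDigit x i = 1} := by
        apply Nat.notMem_of_lt_sInf
        change i < binTau x
        omega
      have h' : ¬ binDigit x i = 1 := fun h => this ⟨hpos, h⟩
      have : binDigit x i < 2 := by unfold binDigit; omega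
      omega
  · have hne : {i : ℕ | 0 < i ∧ binDigit x i = 1}.Nonempty := by
      apply Nat.nonempty_of_pos_sInf
      change 0 < binTau x
      omega
    have := (Nat.sInf_mem hne).2
    change binDigit x (binTau x) = 1 at this
    rwa [ht] at this

lemma odo_formula {x : ℝ} {k : ℕ} (h1 : (1 / 2 : ℝ) ^ (k + 1) ≤ x) (h2 : x < (1 / 2 : ℝ) ^ k) :
    odometer x = x + (1 - 3 * (1 / 2) ^ (k + 1)) := by
  have hx : 0 < x := lt_of_lt_of_le (by positivity) h1
  have hx1 : x < 1 := h2.trans_le (pow_le_one₀ (by norm_num) (by norm_num))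
  obtain ⟨hd0, hd1⟩ := digit_zero h1 h2
  let e : ℕ → ℝ := fun i =>
    (if i = k + 1 then -1 else if 0 < i ∧ i < k + 1 then 1 else 0) * (1 / 2) ^ i
  have he : HasSum e (∑ i ∈ Finset.range (k + 2), e i) := by
    apply hasSum_sum_of_ne_finset_zero
    intro i hi
    simp only [Finset.mem_range, not_lt] at hi
    simp only [e]
    rw [if_neg (by omega), if_neg (by omega), zero_mul]
  have hsum : ∑ i ∈ Finset.range (k + 2), e i = 1 - 3 * (1 / 2) ^ (k + 1) := by
    rw [Finset.sum_range_succ]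
    have h3 : ∀ m ≤ k, ∑ i ∈ Finset.range (m + 1), e i = 1 - (1 / 2) ^ m := by
      intro m hm
      induction m with
      | zero => simp [e]
      | succ m ih =>
        rw [Finset.sum_range_succ, ih (by omega)]
        simp only [e]
        rw [if_neg (by omega), if_pos (by omega)]
        ring
    rw [h3 k le_rfl]
    simp only [e, if_true]
    ring
  rw [hsum] at he
  have := ((hasSum_digits hx.le hx1).add he).tsum_eq
  rw [← this]
  unfold odometer
  congr 1
  ext i
  rw [zpow_half, tau_eq h1 h2, ← add_mul]
  congr 1
  by_cases hi : i = k + 1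
  · subst hi
    simp [hd1]
  · by_cases hi2 : 0 < i ∧ i < k + 1
    · rw [if_pos hi2, if_neg hi, if_pos hi2, hd0 i (by omega)]
      simp
    · rw [if_neg hi2, if_neg hi, if_neg hi, if_neg hi2]
      simp

lemma odo_zero : odometer 0 = 0 := by
  have hd : ∀ i, binDigit 0 i = 0 := by intro i; simp [binDigit_eq]
  have : binTau 0 = 0 := by
    unfold binTau
    simp [hd]
  unfold odometer
  simp [this, hd]

lemma exists_level {x : ℝ} (h0 : 0 < x) (h1 : x < 1) :
    ∃ k : ℕ, (1 / 2 : ℝ) ^ (k + 1) ≤ x ∧ x < (1 / 2 : ℝ) ^ k := by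
  have hex : ∃ k : ℕ, (1 / 2 : ℝ) ^ k ≤ x := by
    obtain ⟨k, hk⟩ := exists_pow_lt_of_lt_one h0 (show (1 / 2 : ℝ) < 1 by norm_num)
    exact ⟨k, hk.le⟩
  classical
  have hs := Nat.find_spec hex
  have hm := fun m => Nat.find_min (m := m) hex
  rcases h : Nat.find hex with _ | k
  · rw [h] at hs; simp at hs; linarith
  · rw [h] at hs
    exact ⟨k, hs, not_le.1 (hm k (by omega))⟩

lemma odo_ge {x : ℝ} (h0 : 1 / 2 ≤ x) (h1 : x < 1) : odometer x = x - 1 / 2 := by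
  rw [odo_formula (k := 0) (by simpa using h0) (by simpa using h1)]
  norm_num
  ring

lemma odo_half {x : ℝ} (h0 : 0 < x) (h1 : x < 1) :
    odometer (x / 2) = (1 + odometer x) / 2 := by
  obtain ⟨k, hk1, hk2⟩ := exists_level h0 h1
  rw [odo_formula hk1 hk2, odo_formula (k := k + 1)]
  · ring
  · rw [pow_succ]; linarith
  · rw [pow_succ]; linarith

lemma odo_mem {x : ℝ} (h0 : 0 ≤ x) (h1 : x < 1) : odometer x ∈ Ico (0 : ℝ) 1 := by
  rcases h0.eq_or_lt with rfl | h0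
  · rw [odo_zero]; simp
  obtain ⟨k, hk1, hk2⟩ := exists_level h0 h1
  rw [odo_formula hk1 hk2]
  have a : (1 / 2 : ℝ) ^ (k + 1) = (1 / 2) ^ k / 2 := by rw [pow_succ]; ring
  have b : (1 / 2 : ℝ) ^ k ≤ 1 := pow_le_one₀ (by norm_num) (by norm_num)
  have c : 0 < (1 / 2 : ℝ) ^ k := by positivity
  constructor <;> linarith

lemma measurable_binDigit (i : ℕ) : Measurable fun x => binDigit x i := by
  simp_rw [binDigit_eq]
  have h : Measurable fun x : ℝ => ⌊x * 2 ^ i⌋₊ :=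
    Nat.measurable_floor.comp (measurable_id.mul_const _)
  exact (measurable_of_countable (fun n : ℕ => n % 2)).comp h

lemma measurable_binTau : Measurable binTau := by
  have hD : ∀ i, MeasurableSet {x | 0 < i ∧ binDigit x i = 1} := by
    intro i
    exact (MeasurableSet.const _).inter
      (measurable_binDigit i (measurableSet_singleton 1))
  apply measurable_to_countable'
  intro k
  rcases Nat.eq_zero_or_pos k with rfl | hk
  · have : binTau ⁻¹' {0} = ⋂ i, {x | 0 < i ∧ binDigit x i = 1}ᶜ := by
      ext x
      simp only [mem_preimage, mem_singleton_iff, binTau, Nat.sInf_eq_zero, mem_iInter,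
        eq_empty_iff_forall_notMem, mem_compl_iff, mem_ofPred_eq]
      simp
    rw [this]
    exact MeasurableSet.iInter fun i => (hD i).compl
  · have : binTau ⁻¹' {k} = {x | 0 < k ∧ binDigit x k = 1} ∩
        ⋂ i, {x | i < k → ¬ (0 < i ∧ binDigit x i = 1)} := by
      ext x
      simp only [mem_preimage, mem_singleton_iff, mem_inter_iff, mem_iInter, mem_ofPred_eq]
      constructor
      · intro h
        have hne : {i : ℕ | 0 < i ∧ binDigit x i = 1}.Nonempty := by
          apply Nat.nonempty_of_pos_sInf
          change 0 < binTau x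
          omega
        have h' : sInf {i : ℕ | 0 < i ∧ binDigit x i = 1} = k := h
        refine ⟨h' ▸ Nat.sInf_mem hne, fun i hi => Nat.notMem_of_lt_sInf (h'.symm ▸ hi)⟩
      · rintro ⟨h1, h2⟩
        apply le_antisymm
        · exact Nat.sInf_le h1
        · apply le_csInf ⟨k, h1⟩
          intro i hi
          by_contra hlt
          exact h2 i (by omega) hi
    rw [this]
    refine (hD k).inter (MeasurableSet.iInter fun i => ?_)
    by_cases h : i < k
    · simp only [h, true_imp_iff]
      exact (hD i).compl
    · simp [h]

lemma measurable_odometer : Measurable odometer := by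
  let t : ℕ → ℝ → ℝ := fun i r => (if 0 < i ∧ i < binTau r then (1 : ℝ)
      else if i = binTau r then 0
      else (binDigit r i : ℝ)) * (2 : ℝ) ^ (-(i : ℤ))
  have ht : ∀ i, Measurable (t i) := by
    intro i
    refine Measurable.mul_const ?_ _
    refine Measurable.ite ?_ measurable_const (Measurable.ite ?_ measurable_const ?_)
    · exact measurable_binTau (MeasurableSet.of_discrete (s := {n | 0 < i ∧ i < n}))
    · exact measurable_binTau (MeasurableSet.of_discrete (s := {n | i = n}))
    · exact (measurable_of_countable (fun n : ℕ => (n : ℝ))).comp (measurable_binDigit i)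
  have hs : ∀ r, Summable fun i => t i r := by
    intro r
    refine Summable.of_nonneg_of_le (f := fun i : ℕ => (1 / 2 : ℝ) ^ i) ?_ ?_
      (summable_geometric_of_lt_one (by norm_num) (by norm_num))
    · intro i
      simp only [t]
      split_ifs <;> positivity
    · intro i
      simp only [t, zpow_half]
      have := binDigit_le r i
      have hp : (0 : ℝ) < (1 / 2) ^ i := by positivity
      split_ifs
      · simp
      · simp
      · exact mul_le_of_le_one_left hp.le this
  refine measurable_of_tendsto_metrizable
    (f := fun n r => ∑ i ∈ Finset.range n, t i r) (fun n => Finset.measurable_sum _ fun i _ => ht i) ?_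
  rw [tendsto_pi_nhds]
  intro r
  exact (hs r).hasSum.tendsto_sum_nat

/-- Level sets of `τ`. -/
def lev (k : ℕ) : Set ℝ := Ico ((1 / 2 : ℝ) ^ (k + 1)) ((1 / 2 : ℝ) ^ k)

/-- Images of level sets. -/
def lev' (k : ℕ) : Set ℝ := Ico (1 - (1 / 2 : ℝ) ^ k) (1 - (1 / 2 : ℝ) ^ (k + 1))

lemma iUnion_lev : ⋃ k, lev k = Ioo (0 : ℝ) 1 := by
  ext x
  simp only [mem_iUnion, lev, mem_Ico, mem_Ioo]
  constructor
  · rintro ⟨k, h1, h2⟩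
    exact ⟨lt_of_lt_of_le (by positivity) h1,
      h2.trans_le (pow_le_one₀ (by norm_num) (by norm_num))⟩
  · rintro ⟨h0, h1⟩
    exact exists_level h0 h1

lemma iUnion_lev' : ⋃ k, lev' k = Ico (0 : ℝ) 1 := by
  ext x
  simp only [mem_iUnion, lev', mem_Ico]
  constructor
  · rintro ⟨k, h1, h2⟩
    have b : (1 / 2 : ℝ) ^ k ≤ 1 := pow_le_one₀ (by norm_num) (by norm_num)
    have c : 0 < (1 / 2 : ℝ) ^ (k + 1) := by positivity
    constructor <;> linarith
  · rintro ⟨h0, h1⟩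
    obtain ⟨n, hn1, hn2⟩ := exists_nat_pow_near_of_lt_one (x := 1 - x) (y := (1 / 2 : ℝ))
      (by linarith) (by linarith) (by norm_num) (by norm_num)
    exact ⟨n, by linarith, by linarith⟩

lemma disj_lev : Pairwise (Function.onFun Disjoint lev) := by
  have : Antitone fun k : ℕ => (1 / 2 : ℝ) ^ k := fun a b h =>
    pow_le_pow_of_le_one (by norm_num) (by norm_num) h
  exact this.pairwise_disjoint_on_Ico_succ

lemma disj_lev' : Pairwise (Function.onFun Disjoint lev') := by
  have : Monotone fun k : ℕ => 1 - (1 / 2 : ℝ) ^ k := fun a b h =>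
    sub_le_sub_left (pow_le_pow_of_le_one (by norm_num) (by norm_num) h) _
  exact this.pairwise_disjoint_on_Ico_succ

lemma mp_odometer : MeasurePreserving odometer unif unif := by
  refine ⟨measurable_odometer, ?_⟩
  ext s hs
  rw [Measure.map_apply measurable_odometer hs]
  have hp := measurable_odometer hs
  have e1 : unif (odometer ⁻¹' s) = volume (odometer ⁻¹' s ∩ ⋃ k, lev k) := by
    rw [iUnion_lev, ← Measure.restrict_apply hp, unif,
      Measure.restrict_congr_set Ioo_ae_eq_Ico]
  have e2 : unif s = volume (s ∩ ⋃ k, lev' k) := by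
    rw [iUnion_lev', ← Measure.restrict_apply hs, unif]
  rw [e1, e2, inter_iUnion, inter_iUnion, measure_iUnion, measure_iUnion]
  · congr 1
    ext k
    have : odometer ⁻¹' s ∩ lev k
        = (fun x => x + (1 - 3 * (1 / 2 : ℝ) ^ (k + 1))) ⁻¹' (s ∩ lev' k) := by
      ext x
      have a : (1 / 2 : ℝ) ^ (k + 1) = (1 / 2) ^ k / 2 := by rw [pow_succ]; ring
      constructor
      · rintro ⟨h1, h2⟩
        have h3 := odo_formula h2.1 h2.2
        refine ⟨?_, ?_⟩
        · change odometer x ∈ s at h1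
          rwa [h3] at h1
        · obtain ⟨h4, h5⟩ := h2
          constructor <;> linarith
      · rintro ⟨h1, h2⟩
        have h4 : x ∈ lev k := by
          obtain ⟨h4, h5⟩ := h2
          constructor <;> linarith
        refine ⟨?_, h4⟩
        change odometer x ∈ s
        rw [odo_formula h4.1 h4.2]
        exact h1
    rw [this, measure_preimage_add_right]
  · exact fun i j h => (disj_lev' h).mono inter_subset_right inter_subset_right
  · exact fun k => hs.inter measurableSet_Ico
  · exact fun i j h => (disj_lev h).mono inter_subset_right inter_subset_right
  · exact fun k => hp.inter measurableSet_Ico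

lemma orbit_dyadic (n : ℕ) : ∀ (A : Set ℝ), (∀ x ∈ Ico (0 : ℝ) 1, (odometer x ∈ A ↔ x ∈ A)) →
    ∀ x ∈ Ico (0 : ℝ) 1, ∀ y ∈ Ico (0 : ℝ) 1, ∀ j : ℤ, x - y = j / 2 ^ n → (x ∈ A ↔ y ∈ A) := by
  induction n with
  | zero =>
    intro A hA x hx y hy j h
    simp only [pow_zero, div_one] at h
    have h1 : (j : ℝ) < 1 := by linarith [hx.2, hy.1]
    have h2 : (-1 : ℝ) < j := by linarith [hx.1, hy.2]
    have h3 : j < 1 := by exact_mod_cast h1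
    have h4 : -1 < j := by exact_mod_cast h2
    have : j = 0 := by omega
    subst this
    have : x = y := by simp at h; linarith
    rw [this]
  | succ n ih =>
    intro A hA x hx y hy j h
    have hA' : ∀ x ∈ Ico (0 : ℝ) 1,
        (odometer x ∈ {z : ℝ | z / 2 ∈ A} ↔ x ∈ {z : ℝ | z / 2 ∈ A}) := by
      intro x hx
      rcases hx.1.eq_or_lt with rfl | h0
      · rw [odo_zero]
      have hm := odo_mem hx.1 hx.2
      have e := odo_half h0 hx.2
      have h1 : odometer ((1 + odometer x) / 2) = odometer x / 2 := by
        rw [odo_ge (by linarith [hm.1]) (by linarith [hm.2])]; ring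
      simp only [mem_ofPred_eq]
      rw [← hA (x / 2) ⟨by linarith, by linarith [hx.2]⟩, e, ← h1]
      exact hA _ ⟨by linarith [hm.1], by linarith [hm.2]⟩
    have red : ∀ x ∈ Ico (0 : ℝ) 1, ∃ (x' : ℝ) (i : ℤ), x' ∈ Ico (0 : ℝ) 1 ∧ x' = 2 * x - i ∧
        (x ∈ A ↔ x' ∈ {z : ℝ | z / 2 ∈ A}) := by
      intro x hx
      by_cases hlt : x < 1 / 2
      · refine ⟨2 * x, 0, ⟨by linarith [hx.1], by linarith⟩, by simp, ?_⟩
        simp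
      · push Not at hlt
        refine ⟨2 * x - 1, 1, ⟨by linarith, by linarith [hx.2]⟩, by simp, ?_⟩
        rw [← hA x hx, odo_ge hlt hx.2]
        simp only [mem_ofPred_eq]
        rw [show (2 * x - 1) / 2 = x - 1 / 2 by ring]
    obtain ⟨x', a, hx', ex, hxA⟩ := red x hx
    obtain ⟨y', b, hy', ey, hyA⟩ := red y hy
    rw [hxA, hyA]
    refine ih _ hA' x' hx' y' hy' (j - (a - b) * 2 ^ n) ?_
    have h2 : (2 : ℝ) ^ n ≠ 0 := by positivity
    rw [ex, ey]
    have : 2 * (x - y) = j / 2 ^ n := by rw [h, pow_succ]; field_simp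
    push_cast
    rw [sub_div, mul_div_cancel_right₀ _ h2, ← this]
    ring

lemma ergodic_odometer : Ergodic odometer unif := by
  refine ⟨mp_odometer, ⟨?_⟩⟩
  intro A hA hinv
  rw [eventuallyConst_set']
  have hfact : Fact ((0 : ℝ) < 1) := ⟨one_pos⟩
  let f : AddCircle (1 : ℝ) → ℝ := fun z => (AddCircle.equivIco 1 0 z : ℝ)
  have hf : Measurable f := measurable_subtype_coe.comp (AddCircle.measurableEquivIco 1 0).measurable
  have hfx : ∀ x : ℝ, f (x : AddCircle (1 : ℝ)) = Int.fract x := by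
    intro x
    simp only [f]
    rw [AddCircle.coe_equivIco_mk_apply]
    simp
  have hB : MeasurableSet (f ⁻¹' A) := hf hA
  have hmk : MeasurePreserving (fun x : ℝ => (x : AddCircle (1 : ℝ))) unif volume := by
    have := AddCircle.measurePreserving_mk (1 : ℝ) 0
    rw [zero_add, Measure.restrict_congr_set Ioc_ae_eq_Icc,
      ← Measure.restrict_congr_set Ico_ae_eq_Icc] at this
    exact this
  have hfr : ∀ᵐ x ∂unif, Int.fract x = x := by
    unfold unif
    filter_upwards [ae_restrict_mem measurableSet_Ico] with x hx
    exact Int.fract_eq_self.2 hx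
  have key := AddCircle.ae_empty_or_univ_of_forall_vadd_ae_eq_self (T := 1) (s := f ⁻¹' A)
    hB.nullMeasurableSet (l := atTop) (u := fun n : ℕ => ((1 / ((2 ^ n : ℕ) : ℝ) : ℝ) : AddCircle (1 : ℝ)))
    ?_ ?_
  · rcases key with h | h
    · left
      have h' := hmk.quasiMeasurePreserving.ae h
      filter_upwards [h', hfr] with x hx hx2
      have : ((x : AddCircle (1 : ℝ)) ∈ f ⁻¹' A) = False := hx
      rw [mem_preimage, hfx, hx2] at this
      exact this
    · right
      have h' := hmk.quasiMeasurePreserving.ae h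
      filter_upwards [h', hfr] with x hx hx2
      have : ((x : AddCircle (1 : ℝ)) ∈ f ⁻¹' A) = True := hx
      rw [mem_preimage, hfx, hx2] at this
      exact this
  · intro n
    refine Filter.EventuallyEq.of_eq ?_
    apply Set.ext
    intro z
    rw [Set.mem_vadd_set_iff_neg_vadd_mem]
    induction z using QuotientAddGroup.induction_on with
    | H x =>
    have e : -((1 / ((2 ^ n : ℕ) : ℝ) : ℝ) : AddCircle (1 : ℝ)) +ᵥ (x : AddCircle (1 : ℝ))
        = ((x - 1 / ((2 ^ n : ℕ) : ℝ) : ℝ) : AddCircle (1 : ℝ)) := by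
      rw [vadd_eq_add, AddCircle.coe_sub]
      abel
    change -((1 / ((2 ^ n : ℕ) : ℝ) : ℝ) : AddCircle (1 : ℝ)) +ᵥ (x : AddCircle (1 : ℝ)) ∈ _ ↔
      (x : AddCircle (1 : ℝ)) ∈ _
    rw [e, mem_preimage, mem_preimage, hfx, hfx]
    refine orbit_dyadic n A (fun y _ => by
      change y ∈ odometer ⁻¹' A ↔ _
      rw [hinv]) _ ⟨Int.fract_nonneg _, Int.fract_lt_one _⟩ _
      ⟨Int.fract_nonneg _, Int.fract_lt_one _⟩
      ((⌊x⌋ - ⌊x - 1 / ((2 ^ n : ℕ) : ℝ)⌋) * 2 ^ n - 1) ?_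
    have h2 : (2 : ℝ) ^ n ≠ 0 := by positivity
    rw [Int.fract, Int.fract]
    push_cast
    rw [sub_div, mul_div_cancel_right₀ _ h2]
    ring
  · have : (addOrderOf ∘ fun n : ℕ => ((1 / ((2 ^ n : ℕ) : ℝ) : ℝ) : AddCircle (1 : ℝ)))
        = fun n => 2 ^ n := by
      ext n
      exact AddCircle.addOrderOf_period_div (by positivity)
    rw [this]
    exact tendsto_pow_atTop_atTop_of_one_lt one_lt_two

instance : IsProbabilityMeasure unif := ⟨by simp [unif]⟩

lemma iter_mem (n : ℕ) {x : ℝ} (hx : x ∈ Ico (0 : ℝ) 1) : odometer^[n] x ∈ Ico (0 : ℝ) 1 := by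
  induction n with
  | zero => exact hx
  | succ n ih =>
    rw [Function.iterate_succ_apply']
    exact odo_mem ih.1 ih.2

lemma meas_comap {T : ℝ → ℝ} (hT : Measurable T) (n : ℕ) :
    Measurable[MeasurableSpace.comap
        (fun r => fun i : Fin (n + 1) => T^[(i : ℕ)] r) inferInstance]
      (fun r => T (T^[n] r)) := by
  have h2 : Measurable fun v : Fin (n + 1) → ℝ => T (v (Fin.last n)) :=
    hT.comp (measurable_pi_apply _)
  intro s hs
  exact ⟨_, h2 hs, rfl⟩

lemma condexp_odometer (n : ℕ) :
    (unif[fun r => odometer^[n + 1] r |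
          MeasurableSpace.comap (fun r => fun i : Fin (n + 1) => odometer^[(i : ℕ)] r)
            inferInstance])
        =ᵐ[unif] fun r => odometer (odometer^[n] r) := by
  have hle : MeasurableSpace.comap (fun r => fun i : Fin (n + 1) => odometer^[(i : ℕ)] r)
            inferInstance ≤ (inferInstance : MeasurableSpace ℝ) := by
    apply Measurable.comap_le
    exact measurable_pi_lambda _ fun i => measurable_odometer.iterate i
  have heq : (fun r => odometer^[n + 1] r) = fun r => odometer (odometer^[n] r) := by
    ext r
    exact Function.iterate_succ_apply' _ _ _
  rw [condExp_of_stronglyMeasurable hle, heq]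
  · rw [heq]
    exact (meas_comap measurable_odometer n).stronglyMeasurable
  · refine Integrable.of_bound (measurable_odometer.iterate (n + 1)).aestronglyMeasurable 1 ?_
    unfold unif
    filter_upwards [ae_restrict_mem measurableSet_Ico] with x hx
    have := iter_mem (n + 1) hx
    rw [Real.norm_eq_abs, abs_of_nonneg this.1]
    exact this.2.le

lemma continuous_odometer {r : ℝ} (hr : r ∈ Ico (0 : ℝ) 1) (hd : ¬ IsDyadic r) :
    ContinuousWithinAt odometer (Ico 0 1) r := by
  have h0 : 0 < r := hr.1.lt_of_ne (by rintro rfl; exact hd ⟨0, 0, by simp⟩)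
  obtain ⟨k, h1, h2⟩ := exists_level h0 hr.2
  have h1' : (1 / 2 : ℝ) ^ (k + 1) < r := h1.lt_of_ne (by
    rintro rfl
    exact hd ⟨1, k + 1, by simp⟩)
  apply ContinuousAt.continuousWithinAt
  have : (fun x => x + (1 - 3 * (1 / 2 : ℝ) ^ (k + 1))) =ᶠ[𝓝 r] odometer := by
    filter_upwards [Ioo_mem_nhds h1' h2] with x hx
    exact (odo_formula hx.1.le hx.2).symm
  exact ContinuousAt.congr (by fun_prop) this

lemma ae_continuous :
    unif {r | ¬ IsDyadic r ∧ ContinuousWithinAt odometer (Ico 0 1) r} = 1 := by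
  have hc : {r | IsDyadic r}.Countable := by
    have : {r | IsDyadic r} ⊆ range fun p : ℤ × ℕ => (p.1 : ℝ) / 2 ^ p.2 := by
      rintro r ⟨a, k, h⟩
      exact ⟨(a, k), h.symm⟩
    exact (countable_range _).mono this
  have h : ∀ᵐ r ∂unif, r ∈ {r | ¬ IsDyadic r ∧ ContinuousWithinAt odometer (Ico 0 1) r} := by
    have h1 : ∀ᵐ r ∂unif, ¬ IsDyadic r := by
      unfold unif
      exact ae_restrict_of_ae (hc.ae_notMem volume)
    have h2 : ∀ᵐ r ∂unif, r ∈ Ico (0 : ℝ) 1 := ae_restrict_mem measurableSet_Ico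
    filter_upwards [h1, h2] with r h1 h2
    exact ⟨h1, continuous_odometer h2 h1⟩
  have h3 := measure_congr (eventuallyEq_univ.2 h)
  rw [measure_univ] at h3
  exact h3

lemma exists_eq_of_ae {g : ℝ → ℝ} (hg : g =ᵐ[unif] odometer) {a b : ℝ} (ha : 0 ≤ a) (hab : a < b)
    (hb : b ≤ 1) : ∃ x ∈ Ioo a b, g x = odometer x := by
  have h1 : ∀ᵐ x ∂(volume.restrict (Ioo a b)), g x = odometer x :=
    ae_restrict_of_ae_restrict_of_subset
      (show Ioo a b ⊆ Ico 0 1 from fun x hx => ⟨ha.trans hx.1.le, hx.2.trans_le hb⟩) hg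
  have h2 : ∀ᵐ x ∂(volume.restrict (Ioo a b)), x ∈ Ioo a b := ae_restrict_mem measurableSet_Ioo
  have : (ae (volume.restrict (Ioo a b))).NeBot := by
    rw [ae_neBot]
    intro h
    rw [Measure.restrict_eq_zero, Real.volume_Ioo, ENNReal.ofReal_eq_zero] at h
    linarith
  obtain ⟨x, hx1, hx2⟩ := (h2.and h1).exists
  exact ⟨x, hx1, hx2⟩

lemma not_continuous {g : ℝ → ℝ} (hg : g =ᵐ[unif] odometer) :
    ¬ ContinuousWithinAt g (Ico 0 1) (1 / 2) := by
  intro hc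
  rw [Metric.continuousWithinAt_iff] at hc
  obtain ⟨δ, hδ, h⟩ := hc (1 / 8) (by norm_num)
  set d := min δ (1 / 8) with hd
  have hd0 : 0 < d := lt_min hδ (by norm_num)
  have hd1 : d ≤ δ := min_le_left _ _
  have hd2 : d ≤ 1 / 8 := min_le_right _ _
  obtain ⟨x, hx, hxe⟩ := exists_eq_of_ae hg (a := 1 / 2) (b := 1 / 2 + d) (by norm_num)
    (by linarith) (by linarith)
  obtain ⟨y, hy, hye⟩ := exists_eq_of_ae hg (a := 1 / 2 - d) (b := 1 / 2) (by linarith)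
    (by linarith) (by linarith)
  obtain ⟨hx1, hx2⟩ := hx
  obtain ⟨hy1, hy2⟩ := hy
  have h1 := h (x := x) ⟨by linarith, by linarith⟩
    (by rw [Real.dist_eq, abs_lt]; constructor <;> linarith)
  have h2 := h (x := y) ⟨by linarith, by linarith⟩
    (by rw [Real.dist_eq, abs_lt]; constructor <;> linarith)
  rw [hxe, odo_ge hx1.le (by linarith), Real.dist_eq, abs_lt] at h1
  rw [hye, odo_formula (k := 1) (by norm_num; linarith) (by norm_num; linarith),
    Real.dist_eq, abs_lt] at h2
  norm_num at h2
  linarith [h1.1, h1.2, h2.1, h2.2]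


/-- The odometer process `X_n = S^n r`, `r` uniform on `[0,1)`, is a stationary
ergodic (order one Markov) process whose conditional expectation is
`E(X_{n+1} | X_0, …, X_n) = S(X_n)`; the map `S` is continuous at every non-dyadic
point of `[0,1)`, so this conditional expectation is almost surely continuous, but
no a.e. modification of `S` is continuous at `0.5`. -/
theorem odometer_process_as_continuous_condexp :
    MeasurePreserving odometer unif unif ∧
    Ergodic odometer unif ∧
    (∀ n : ℕ,
      (unif[fun r => odometer^[n + 1] r |
          MeasurableSpace.comap (fun r => fun i : Fin (n + 1) => odometer^[(i : ℕ)] r)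
            inferInstance])
        =ᵐ[unif] fun r => odometer (odometer^[n] r)) ∧
    (∀ r ∈ Ico (0 : ℝ) 1, ¬ IsDyadic r → ContinuousWithinAt odometer (Ico 0 1) r) ∧
    (unif {r | ¬ IsDyadic r ∧ ContinuousWithinAt odometer (Ico 0 1) r} = 1) ∧
    (∀ g : ℝ → ℝ, g =ᵐ[unif] odometer → ¬ ContinuousWithinAt g (Ico 0 1) (1 / 2)) := by
  exact ⟨mp_odometer, ergodic_odometer, condexp_odometer, fun r hr hd => continuous_odometer hr hd,
    ae_continuous, fun g hg => not_continuous hg⟩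

end
end

section
/- Let {X_n} be a stationary ergodic process taking values in a finite alphabet with entropy rate H, and let ζ_k be the block-recurrence stopping times defined (without quantization) by ζ_0 = 0 and ζ_k = ζ_{k-1} + min{t>0 : X_{ζ_{k-1}-(l_k-1)+t}^{ζ_{k-1}+t} = X_{ζ_{k-1}-(l_k-1)}^{ζ_{k-1}}}. If Σ_k (k+1) 2^{-l_k ε} < ∞ for some ε > 0, then ζ_k < 2^{l_k(H+ε)} eventually almost surely. -/
open MeasureTheory Filter

noncomputable section

variable {Ω A : Type*}

/-- Waiting time for the next recurrence of the block of length `l k` ending at `b`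
(no quantization, finite alphabet). -/
def recEtaA [DecidableEq A] (l : ℕ → ℕ) (X : ℤ → Ω → A) (k : ℕ) (b : ℤ) (ω : Ω) : ℕ :=
  sInf {t : ℕ | 0 < t ∧ ∀ i < l k, X (b + t - i) ω = X (b - i) ω}

/-- The block recurrence stopping times for a finite alphabet process. -/
def recZetaA [DecidableEq A] (l : ℕ → ℕ) (X : ℤ → Ω → A) : ℕ → Ω → ℤ
  | 0, _ => 0
  | k + 1, ω => recZetaA l X k ω + recEtaA l X (k + 1) (recZetaA l X k ω) ω


/-- Running maxima of Birkhoff sums. -/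
def bmax {α : Type*} (S : α → α) (g : α → ℝ) : ℕ → α → ℝ
  | 0, _ => 0
  | n + 1, x => max 0 (g x + bmax S g n (S x))

lemma bmax_nonneg {α : Type*} (S : α → α) (g : α → ℝ) (n : ℕ) (x : α) : 0 ≤ bmax S g n x := by
  cases n <;> simp [bmax]

lemma bmax_mono_succ {α : Type*} (S : α → α) (g : α → ℝ) (n : ℕ) (x : α) :
    bmax S g n x ≤ bmax S g (n + 1) x := by
  induction n generalizing x with
  | zero => simp [bmax]
  | succ n ih =>
    simp only [bmax] at ih ⊢
    have := ih (S x)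
    exact max_le_max le_rfl (by linarith)

lemma sum_le_bmax {α : Type*} (S : α → α) (g : α → ℝ) (n : ℕ) (x : α) :
    ∑ j ∈ Finset.range n, g (S^[j] x) ≤ bmax S g n x := by
  induction n generalizing x with
  | zero => simp [bmax]
  | succ n ih =>
    rw [Finset.sum_range_succ']
    have := ih (S x)
    simp only [Function.iterate_succ, Function.comp_apply, Function.iterate_zero, id] at this ⊢
    simp only [bmax]
    refine le_max_of_le_right ?_
    linarith

lemma ergo_bdd {α : Type*} [MeasurableSpace α] {ν : Measure α} [IsProbabilityMeasure ν]
    {S : α → α} (hS : Ergodic S ν) (g : α → ℝ) (hg : Measurable g) (hgi : Integrable g ν)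
    (hneg : ∫ x, g x ∂ν < 0) :
    ∀ᵐ x ∂ν, ∃ K : ℝ, ∀ n, ∑ j ∈ Finset.range n, g (S^[j] x) ≤ K := by
  have hm : ∀ n, Measurable (bmax S g n) := by
    intro n
    induction n with
    | zero => exact measurable_const
    | succ n ih => exact measurable_const.max (hg.add (ih.comp hS.measurable))
  have hi : ∀ n, Integrable (bmax S g n) ν := by
    intro n
    induction n with
    | zero => exact integrable_zero _ _ _
    | succ n ih =>
      exact (integrable_zero _ _ _).sup
        (hgi.add (hS.toMeasurePreserving.integrable_comp_of_integrable ih))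
  set E : Set α := {x | BddAbove (Set.range fun n => bmax S g n x)} with hE
  have hEm : MeasurableSet E := measurableSet_bddAbove_range hm
  have hinv : S ⁻¹' E = E := by
    ext x
    simp only [hE, Set.mem_preimage, Set.mem_ofPred_eq, bddAbove_def, Set.mem_range,
      forall_exists_index, forall_apply_eq_imp_iff]
    constructor
    · rintro ⟨K, hK⟩
      refine ⟨max 0 (g x + K), fun n => ?_⟩
      refine (bmax_mono_succ S g n x).trans ?_
      simp only [bmax]
      exact max_le_max le_rfl (by linarith [hK n])
    · rintro ⟨K, hK⟩
      refine ⟨K - g x, fun n => ?_⟩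
      have := hK (n + 1)
      simp only [bmax] at this
      linarith [(le_max_right _ _).trans this]
  rcases hS.toPreErgodic.ae_mem_or_ae_notMem hEm hinv with h | h
  · filter_upwards [h] with x hx
    obtain ⟨K, hK⟩ := hx
    exact ⟨K, fun n => (sum_le_bmax S g n x).trans (hK ⟨n, rfl⟩)⟩
  · exfalso
    have h' : ∀ᵐ x ∂ν, S x ∉ E := hS.toMeasurePreserving.quasiMeasurePreserving.ae h
    have hnn : ∀ n, 0 ≤ ∫ x, (bmax S g (n + 1) x - bmax S g n (S x)) ∂ν := by
      intro n
      have hcomp : Integrable (fun x => bmax S g n (S x)) ν :=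
        hS.toMeasurePreserving.integrable_comp_of_integrable (hi n)
      rw [integral_sub (hi _) hcomp]
      have : ∫ x, bmax S g n (S x) ∂ν = ∫ x, bmax S g n x ∂ν := by
        have := integral_map (μ := ν) hS.measurable.aemeasurable
          (f := bmax S g n) (hm n).aestronglyMeasurable
        rw [hS.map_eq] at this
        exact this.symm
      rw [this, sub_nonneg]
      exact integral_mono (hi _) (hi _) (bmax_mono_succ S g n)
    have hlim : Tendsto (fun n => ∫ x, (bmax S g (n + 1) x - bmax S g n (S x)) ∂ν) atTop
        (nhds (∫ x, g x ∂ν)) := by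
      refine tendsto_integral_of_dominated_convergence (fun x => |g x|) ?_ hgi.abs ?_ ?_
      · intro n
        exact ((hm (n+1)).sub ((hm n).comp hS.measurable)).aestronglyMeasurable
      · intro n
        refine Eventually.of_forall fun x => ?_
        have h0 := bmax_nonneg S g n (S x)
        simp only [bmax, Real.norm_eq_abs]
        rcases le_total 0 (g x + bmax S g n (S x)) with h1 | h1
        · rw [max_eq_right h1]; simp
        · rw [max_eq_left h1, zero_sub, abs_neg, abs_of_nonneg h0]
          rw [abs_of_nonpos (by linarith)]; linarith
      · filter_upwards [h'] with x hx
        have : ∃ N, -g x ≤ bmax S g N (S x) := by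
          by_contra hcon
          push Not at hcon
          exact hx ⟨-g x, by rintro _ ⟨n, rfl⟩; exact (hcon n).le⟩
        obtain ⟨N, hN⟩ := this
        refine tendsto_const_nhds.congr' ?_
        filter_upwards [eventually_ge_atTop N] with n hn
        have hmono : Monotone fun n => bmax S g n (S x) :=
          monotone_nat_of_le_succ fun n => bmax_mono_succ S g n (S x)
        have := hmono hn
        simp only [bmax] at this ⊢
        rw [max_eq_right (by linarith)]; ring
    exact absurd (ge_of_tendsto' hlim hnn) (not_le.2 hneg)

/-- Return time to own label. -/
def ret {α W : Type*} (e : α → α) (L : α → W) (x : α) : ℕ :=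
  sInf {t : ℕ | 0 < t ∧ L (e^[t] x) = L x}

lemma ret_eq_iff {α W : Type*} (e : α → α) (L : α → W) (x : α) {t : ℕ} (ht : 0 < t) :
    ret e L x = t ↔ L (e^[t] x) = L x ∧ ∀ s, 0 < s → s < t → L (e^[s] x) ≠ L x := by
  constructor
  · intro h
    have hne : {t : ℕ | 0 < t ∧ L (e^[t] x) = L x}.Nonempty := by
      apply Nat.nonempty_of_pos_sInf
      unfold ret at h; omega
    have hmem := Nat.sInf_mem hne
    change ret e L x ∈ _ at hmem
    rw [h] at hmem
    refine ⟨hmem.2, fun s hs hst heq => ?_⟩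
    have := Nat.sInf_le (show s ∈ {t : ℕ | 0 < t ∧ L (e^[t] x) = L x} from ⟨hs, heq⟩)
    unfold ret at h; omega
  · rintro ⟨h1, h2⟩
    have hmem : t ∈ {t : ℕ | 0 < t ∧ L (e^[t] x) = L x} := ⟨ht, h1⟩
    refine le_antisymm (Nat.sInf_le hmem) ?_
    have := Nat.sInf_mem ⟨t, hmem⟩
    by_contra hcon
    exact h2 _ this.1 (not_le.1 hcon) this.2

lemma ret_label {α W : Type*} (e : α → α) (L : α → W) (x : α) :
    L (e^[ret e L x] x) = L x := by
  rcases Nat.eq_zero_or_pos (ret e L x) with h | h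
  · rw [h]; rfl
  · exact ((ret_eq_iff e L x h).1 rfl).1

lemma ret_inverse {α W : Type*} {e f : α → α} (hef : Function.LeftInverse f e) (L : α → W) (x : α)
    {t : ℕ} (ht : 0 < t) : ret e L x = t ↔ ret f L (e^[t] x) = t := by
  have key : ∀ s, s ≤ t → f^[s] (e^[t] x) = e^[t - s] x := by
    intro s hs
    obtain ⟨r, rfl⟩ := Nat.exists_eq_add_of_le hs
    rw [Function.iterate_add_apply, hef.iterate s]
    simp
  rw [ret_eq_iff e L x ht, ret_eq_iff f L _ ht, key t le_rfl, Nat.sub_self]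
  constructor
  · rintro ⟨h1, h2⟩
    refine ⟨h1.symm, fun s hs hst => ?_⟩
    rw [key s hst.le, h1]
    exact h2 _ (by omega) (by omega)
  · rintro ⟨h1, h2⟩
    refine ⟨h1.symm, fun s hs hst => ?_⟩
    have := h2 (t - s) (by omega) (by omega)
    rw [key _ (by omega), Nat.sub_sub_self hst.le, ← h1] at this
    exact this

section retur
variable {α W : Type*} [MeasurableSpace α] [Finite W] [MeasurableSpace W]
  [MeasurableSingletonClass W]

lemma meas_label {f g : α → W} (hf : Measurable f) (hg : Measurable g) :
    MeasurableSet {x | f x = g x} := by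
  have : Countable W := Finite.to_countable
  have h : {x | f x = g x} = ⋃ w, (f ⁻¹' {w} ∩ g ⁻¹' {w}) := by
    ext x
    simp [eq_comm]
  rw [h]
  exact MeasurableSet.iUnion fun w => (hf (measurableSet_singleton w)).inter
    (hg (measurableSet_singleton w))

lemma ret_measurable {e : α → α} (he : Measurable e) {L : α → W} (hL : Measurable L) :
    Measurable (ret e L) := by
  have hpos : ∀ t, 0 < t → MeasurableSet (ret e L ⁻¹' {t}) := by
    intro t ht
    have : ret e L ⁻¹' {t} = {x | L (e^[t] x) = L x} ∩
        ⋂ s, ⋂ (_ : 0 < s), ⋂ (_ : s < t), {x | L (e^[s] x) = L x}ᶜ := by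
      ext x
      simp [ret_eq_iff e L x ht]
    rw [this]
    refine (meas_label (hL.comp (he.iterate t)) hL).inter ?_
    exact MeasurableSet.iInter fun s => MeasurableSet.iInter fun _ => MeasurableSet.iInter fun _ =>
      (meas_label (hL.comp (he.iterate s)) hL).compl
  refine measurable_to_countable' fun t => ?_
  rcases Nat.eq_zero_or_pos t with rfl | ht
  · have : ret e L ⁻¹' {0} = (⋃ t, ⋃ (_ : 0 < t), ret e L ⁻¹' {t})ᶜ := by
      ext x
      simp only [Set.mem_preimage, Set.mem_singleton_iff, Set.mem_compl_iff, Set.mem_iUnion,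
        not_exists]
      constructor
      · intro h i hi hh; omega
      · intro h
        by_contra h0
        exact h _ (Nat.pos_of_ne_zero h0) rfl
    rw [this]
    exact (MeasurableSet.iUnion fun t => MeasurableSet.iUnion fun ht => hpos t ht).compl
  · exact hpos t ht

lemma ret_pos {ν : Measure α} [IsProbabilityMeasure ν] {e : α → α}
    (he : MeasurePreserving e ν ν) {L : α → W} (hL : Measurable L) :
    ∀ᵐ x ∂ν, 0 < ret e L x := by
  have : ∀ w : W, ∀ᵐ x ∂ν, x ∈ L ⁻¹' {w} → ∃ᶠ n in atTop, e^[n] x ∈ L ⁻¹' {w} := fun w =>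
    he.conservative.ae_mem_imp_frequently_image_mem
      (hL (measurableSet_singleton w)).nullMeasurableSet
  have : Countable W := Finite.to_countable
  have h2 := ae_all_iff.2 ‹∀ w : W, ∀ᵐ x ∂ν, x ∈ L ⁻¹' {w} → ∃ᶠ n in atTop, e^[n] x ∈ L ⁻¹' {w}›
  filter_upwards [h2] with x hx
  have h3 := hx (L x) rfl
  obtain ⟨n, hn, hn'⟩ := (frequently_atTop.1 h3) 1
  have := Nat.sInf_mem (⟨n, hn, hn'⟩ : {t : ℕ | 0 < t ∧ L (e^[t] x) = L x}.Nonempty)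
  exact this.1

lemma ret_measurePreserving {ν : Measure α} [IsProbabilityMeasure ν] {e f : α → α}
    (he : MeasurePreserving e ν ν) (hf : MeasurePreserving f ν ν)
    (hef : Function.LeftInverse f e) {L : α → W} (hL : Measurable L) :
    MeasurePreserving (fun x => e^[ret e L x] x) ν ν := by
  have hR : Measurable (fun x => e^[ret e L x] x) := by
    intro B hB
    have : (fun x => e^[ret e L x] x) ⁻¹' B = ⋃ t, (ret e L ⁻¹' {t} ∩ e^[t] ⁻¹' B) := by
      ext x
      simp
    rw [this]
    exact MeasurableSet.iUnion fun t => ((ret_measurable he.measurable hL)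
      (measurableSet_singleton t)).inter ((he.measurable.iterate t) hB)
  refine ⟨hR, ?_⟩
  ext B hB
  rw [Measure.map_apply hR hB]
  have hdec : ∀ (r : α → ℕ) (_ : Measurable r) (D : Set α) (_ : MeasurableSet D),
      ν D = ∑' t, ν (r ⁻¹' {t} ∩ D) := by
    intro r hr D hD
    rw [← measure_iUnion]
    · congr 1
      ext x; simp
    · intro s t hst
      rw [Function.onFun, Set.disjoint_left]
      rintro x ⟨h1, _⟩ ⟨h2, _⟩
      exact hst (h1.symm.trans h2)
    · intro t
      exact (hr (measurableSet_singleton t)).inter hD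
  rw [hdec (ret e L) (ret_measurable he.measurable hL) _ (hR hB),
    hdec (ret f L) (ret_measurable hf.measurable hL) _ hB]
  congr 1
  ext t
  rcases Nat.eq_zero_or_pos t with rfl | ht
  · have h0 : ∀ (e : α → α), MeasurePreserving e ν ν → ∀ D : Set α,
        ν (ret e L ⁻¹' {0} ∩ D) = 0 := by
      intro e he D
      refine measure_mono_null Set.inter_subset_left ?_
      have := ret_pos he hL
      rw [ae_iff] at this
      refine measure_mono_null ?_ this
      intro x hx
      simp only [Set.mem_preimage, Set.mem_singleton_iff] at hx
      simp [hx]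
    rw [h0 e he, h0 f hf]
  · have : ret e L ⁻¹' {t} ∩ (fun x => e^[ret e L x] x) ⁻¹' B
        = e^[t] ⁻¹' (ret f L ⁻¹' {t} ∩ B) := by
      ext x
      simp only [Set.mem_inter_iff, Set.mem_preimage, Set.mem_singleton_iff]
      rw [← ret_inverse hef L x ht]
      constructor
      · rintro ⟨h1, h2⟩; exact ⟨h1, by rwa [h1] at h2⟩
      · rintro ⟨h1, h2⟩; exact ⟨h1, by rwa [h1]⟩
    rw [this]
    exact (he.iterate t).measure_preimage
      (((ret_measurable hf.measurable hL) (measurableSet_singleton t)).inter hB).nullMeasurableSet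

lemma kac_set {ν : Measure α} [IsProbabilityMeasure ν] {e f : α → α}
    (he : MeasurePreserving e ν ν) (hf : MeasurePreserving f ν ν)
    (hef : Function.LeftInverse f e) {L : α → W} (hL : Measurable L) (w : W) :
    ∫⁻ x in L ⁻¹' {w}, (ret e L x : ENNReal) ∂ν ≤ 1 := by
  -- the set of points whose last visit to `w` was exactly `n` steps ago
  let D : ℕ → Set α := fun n => {x | L (f^[n] x) = w ∧ ∀ s, s < n → L (f^[s] x) ≠ w}
  have hDm : ∀ n, MeasurableSet (D n) := by
    intro n
    have : D n = (f^[n] ⁻¹' (L ⁻¹' {w})) ∩ ⋂ s, ⋂ (_ : s < n), (f^[s] ⁻¹' (L ⁻¹' {w}))ᶜ := by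
      ext x; simp [D]
    rw [this]
    exact ((hf.measurable.iterate n) (hL (measurableSet_singleton w))).inter
      (MeasurableSet.iInter fun s => MeasurableSet.iInter fun _ =>
        ((hf.measurable.iterate s) (hL (measurableSet_singleton w))).compl)
  have hDd : Pairwise (Function.onFun Disjoint D) := by
    intro m n hmn
    rw [Function.onFun, Set.disjoint_left]
    rintro x ⟨h1, h2⟩ ⟨h3, h4⟩
    rcases lt_or_gt_of_ne hmn with h | h
    · exact h4 m h h1
    · exact h2 n h h3
  have hD1 : ∑' n, ν (D n) ≤ 1 := by
    rw [← measure_iUnion hDd hDm]; exact prob_le_one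
  have hrm := ret_measurable he.measurable hL
  have hpt : ∀ x, (ret e L x : ENNReal) = ∑' n : ℕ, Set.indicator {x | n < ret e L x} 1 x := by
    intro x
    rw [tsum_eq_sum (s := Finset.range (ret e L x))]
    · rw [Finset.sum_congr rfl (g := fun _ => (1 : ENNReal))]
      · simp
      · intro n hn
        simp only [Finset.mem_range] at hn
        simp [hn]
    · intro n hn
      simp only [Finset.mem_range] at hn
      simp [hn]
  have hms : ∀ n : ℕ, MeasurableSet {x | n < ret e L x} := fun n =>
    measurableSet_lt measurable_const hrm
  calc ∫⁻ x in L ⁻¹' {w}, (ret e L x : ENNReal) ∂ν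
      = ∫⁻ x in L ⁻¹' {w}, ∑' n : ℕ, Set.indicator {x | n < ret e L x} 1 x ∂ν := by
        simp_rw [hpt]
    _ = ∑' n : ℕ, ν ({x | n < ret e L x} ∩ L ⁻¹' {w}) := by
        rw [lintegral_tsum]
        · congr 1; ext n
          rw [lintegral_indicator_one (hms n), Measure.restrict_apply (hms n)]
        · intro n
          exact (measurable_one.indicator (hms n)).aemeasurable
    _ ≤ ∑' n, ν (D n) := by
        refine ENNReal.tsum_le_tsum fun n => ?_
        rw [← (he.iterate n).measure_preimage (hDm n).nullMeasurableSet]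
        refine measure_mono ?_
        rintro x ⟨h1, h2⟩
        simp only [Set.mem_ofPred_eq, Set.mem_preimage, Set.mem_singleton_iff] at h1 h2
        have key : ∀ s, s ≤ n → f^[s] (e^[n] x) = e^[n - s] x := by
          intro s hs
          obtain ⟨r, rfl⟩ := Nat.exists_eq_add_of_le hs
          rw [Function.iterate_add_apply, hef.iterate s]
          simp
        refine ⟨?_, fun s hs => ?_⟩
        · rw [key n le_rfl]; simpa using h2
        · rw [key s hs.le, ← h2]
          exact ((ret_eq_iff e L x (by omega)).1 rfl).2 _ (by omega) (by omega)
    _ ≤ 1 := hD1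

lemma kac_weighted {ν : Measure α} [IsProbabilityMeasure ν] {e f : α → α}
    (he : MeasurePreserving e ν ν) (hf : MeasurePreserving f ν ν)
    (hef : Function.LeftInverse f e) {L : α → W} (hL : Measurable L) :
    ∫⁻ x, (ret e L x : ENNReal) * ν (L ⁻¹' {L x}) ∂ν ≤ 1 := by
  have := Fintype.ofFinite W
  have hun : (⋃ w ∈ (Finset.univ : Finset W), L ⁻¹' {w}) = Set.univ := by
    ext x; simp
  have hdis : Set.PairwiseDisjoint (↑(Finset.univ : Finset W)) (fun w => L ⁻¹' {w}) := by
    intro a _ b _ hab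
    rw [Function.onFun, Set.disjoint_left]
    intro x h1 h2
    exact hab (h1.symm.trans h2)
  have hmw : ∀ w : W, MeasurableSet (L ⁻¹' {w}) := fun w => hL (measurableSet_singleton w)
  rw [← setLIntegral_univ, ← hun, lintegral_biUnion_finset hdis (fun w _ => hmw w)]
  calc ∑ w, ∫⁻ x in L ⁻¹' {w}, (ret e L x : ENNReal) * ν (L ⁻¹' {L x}) ∂ν
      = ∑ w, (∫⁻ x in L ⁻¹' {w}, (ret e L x : ENNReal) ∂ν) * ν (L ⁻¹' {w}) := by
        refine Finset.sum_congr rfl fun w _ => ?_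
        rw [← lintegral_mul_const']
        · refine setLIntegral_congr_fun (hmw w) fun x hx => ?_
          have hx' : L x = w := hx
          simp only [hx']
        · exact measure_ne_top _ _
    _ ≤ ∑ w, 1 * ν (L ⁻¹' {w}) := by
        refine Finset.sum_le_sum fun w _ => ?_
        gcongr
        exact kac_set he hf hef hL w
    _ = 1 := by
        simp only [one_mul]
        rw [← measure_biUnion_finset hdis (fun w _ => hmw w), hun, measure_univ]

end retur

/-- Backward shift. -/
def shB {A : Type*} (x : ℤ → A) : ℤ → A := fun n => x (n - 1)

/-- Forward shift. -/
def shF {A : Type*} (x : ℤ → A) : ℤ → A := fun n => x (n + 1)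

lemma shB_iter {A : Type*} (j : ℕ) (x : ℤ → A) (z : ℤ) : (shB^[j] x) z = x (z - j) := by
  induction j generalizing x with
  | zero => simp
  | succ j ih =>
    rw [Function.iterate_succ_apply, ih]
    simp only [shB]; congr 1; push_cast; ring

lemma shF_iter {A : Type*} (j : ℕ) (x : ℤ → A) (z : ℤ) : (shF^[j] x) z = x (z + j) := by
  induction j generalizing x with
  | zero => simp
  | succ j ih =>
    rw [Function.iterate_succ_apply, ih]
    simp only [shF]; congr 1; push_cast; ring

/-- The block of length `n` ending at time `0`, read backwards. -/
def blk {A : Type*} (n : ℕ) (x : ℤ → A) : Fin n → A := fun i => x (-(i : ℤ))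

lemma blk_eq_iff {A : Type*} (n : ℕ) (x y : ℤ → A) :
    blk n x = blk n y ↔ ∀ i : ℕ, i < n → x (-(i : ℤ)) = y (-(i : ℤ)) := by
  constructor
  · intro h i hi
    exact congrFun h ⟨i, hi⟩
  · intro h
    ext i
    exact h i i.2

/-- A two-sided sequence extending a word. -/
def extw {A : Type*} (a0 : A) {N : ℕ} (w : Fin N → A) : ℤ → A := fun z =>
  if h : (-z).toNat < N then w ⟨(-z).toNat, h⟩ else a0

lemma blk_extw {A : Type*} (a0 : A) {N : ℕ} (w : Fin N → A) : blk N (extw a0 w) = w := by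
  ext i
  simp [blk, extw]

set_option linter.unusedSectionVars false

section pb
variable {A : Type*} [MeasurableSpace A]

/-- Probability of the block of length `n` ending at time `0`. -/
def Qb (ν : Measure (ℤ → A)) (n : ℕ) (x : ℤ → A) : ℝ := ν.real (blk n ⁻¹' {blk n x})

lemma Qb_congr (ν : Measure (ℤ → A)) {n : ℕ} {x y : ℤ → A} (h : blk n x = blk n y) :
    Qb ν n x = Qb ν n y := by
  unfold Qb; rw [h]

lemma Qb_nonneg (ν : Measure (ℤ → A)) (n : ℕ) (x : ℤ → A) : 0 ≤ Qb ν n x := measureReal_nonneg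

/-- Markov approximation of order `m`. -/
def Ub (ν : Measure (ℤ → A)) (m n : ℕ) (x : ℤ → A) : ℝ :=
  Qb ν m x * ∏ j ∈ Finset.range n, (Qb ν (m + 1) (shB^[j] x) / Qb ν m (shB^[j] x))

lemma Ub_nonneg (ν : Measure (ℤ → A)) (m n : ℕ) (x : ℤ → A) : 0 ≤ Ub ν m n x :=
  mul_nonneg (Qb_nonneg _ _ _) (Finset.prod_nonneg fun _ _ =>
    div_nonneg (Qb_nonneg _ _ _) (Qb_nonneg _ _ _))

lemma Ub_congr (ν : Measure (ℤ → A)) {m n : ℕ} {x y : ℤ → A}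
    (h : blk (m + n) x = blk (m + n) y) : Ub ν m n x = Ub ν m n y := by
  rw [blk_eq_iff] at h
  have hsh : ∀ j k, j + k ≤ m + n → blk k (shB^[j] x) = blk k (shB^[j] y) := by
    intro j k hjk
    rw [blk_eq_iff]
    intro i hi
    rw [shB_iter, shB_iter]
    have := h (i + j) (by omega)
    push_cast at this
    rwa [neg_add] at this
  unfold Ub
  congr 1
  · exact Qb_congr ν (hsh 0 m (by omega))
  · refine Finset.prod_congr rfl fun j hj => ?_
    rw [Finset.mem_range] at hj
    rw [Qb_congr ν (hsh j (m + 1) (by omega)), Qb_congr ν (hsh j m (by omega))]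

variable [Fintype A] [MeasurableSingletonClass A]

lemma blk_measurable (n : ℕ) : Measurable (blk n : (ℤ → A) → Fin n → A) :=
  measurable_pi_lambda _ fun _ => measurable_pi_apply _

lemma Qb_measurable (ν : Measure (ℤ → A)) (n : ℕ) : Measurable (Qb ν n) := by
  have : Qb ν n = (fun w => ν.real (blk n ⁻¹' {w})) ∘ blk n := rfl
  rw [this]
  exact (measurable_of_finite _).comp (blk_measurable n)

variable (ν : Measure (ℤ → A)) [IsProbabilityMeasure ν]

lemma Qb_le_one (n : ℕ) (x : ℤ → A) : Qb ν n x ≤ 1 := measureReal_le_one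

lemma Qb_zero (x : ℤ → A) : Qb ν 0 x = 1 := by
  have : (blk 0 ⁻¹' {blk 0 x} : Set (ℤ → A)) = Set.univ := by
    ext y; simp [blk_eq_iff]
  simp [Qb, this]

lemma Qb_anti {m n : ℕ} (h : m ≤ n) (x : ℤ → A) : Qb ν n x ≤ Qb ν m x := by
  refine measureReal_mono ?_
  intro y hy
  simp only [Set.mem_preimage, Set.mem_singleton_iff, blk_eq_iff] at hy ⊢
  intro i hi
  exact hy i (by omega)

lemma Qb_pos : ∀ᵐ x ∂ν, ∀ n, 0 < Qb ν n x := by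
  rw [ae_all_iff]
  intro n
  have h : ∀ w : Fin n → A, ∀ᵐ x ∂ν, blk n x = w → 0 < Qb ν n x := by
    intro w
    by_cases hw : ν (blk n ⁻¹' {w}) = 0
    · have : ∀ᵐ x ∂ν, x ∉ blk n ⁻¹' {w} := measure_eq_zero_iff_ae_notMem.1 hw
      filter_upwards [this] with x hx hx'
      exact absurd hx' hx
    · refine Eventually.of_forall fun x hx => ?_
      unfold Qb
      rw [hx]
      exact ENNReal.toReal_pos hw (measure_ne_top _ _)
  filter_upwards [ae_all_iff.2 h] with x hx
  exact hx _ rfl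

lemma sum_Qb (m : ℕ) (y : ℤ → A) :
    ∑ a, Qb ν (m + 1) (Function.update y (-(m : ℤ)) a) = Qb ν m y := by
  classical
  have hk : ∀ (a : A) (z : ℤ → A), blk (m + 1) z = blk (m + 1) (Function.update y (-(m : ℤ)) a) ↔
      blk m z = blk m y ∧ z (-(m : ℤ)) = a := by
    intro a z
    rw [blk_eq_iff, blk_eq_iff]
    constructor
    · intro h
      refine ⟨fun i hi => ?_, ?_⟩
      · rw [h i (by omega), Function.update_of_ne (by omega)]
      · rw [h m (by omega), Function.update_self]
    · rintro ⟨h1, h2⟩ i hi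
      rcases Nat.lt_succ_iff_lt_or_eq.1 hi with h | rfl
      · rw [h1 i h, Function.update_of_ne (by omega)]
      · rw [h2, Function.update_self]
  unfold Qb
  rw [← measureReal_biUnion_finset]
  · congr 1
    ext z
    simp [hk]
  · intro a _ b _ hab
    rw [Function.onFun, Set.disjoint_left]
    intro z h1 h2
    simp only [Set.mem_preimage, Set.mem_singleton_iff, hk] at h1 h2
    exact hab (h1.2.symm.trans h2.2)
  · intro a _
    exact blk_measurable _ (measurableSet_singleton _)

lemma sum_qb (N : ℕ) : ∑ w : Fin N → A, ν.real (blk N ⁻¹' {w}) = 1 := by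
  classical
  rw [← measureReal_biUnion_finset]
  · have : (⋃ w ∈ (Finset.univ : Finset (Fin N → A)), blk N ⁻¹' {w}) = Set.univ := by
      ext z; simp
    rw [this]; simp
  · intro a _ b _ hab
    rw [Function.onFun, Set.disjoint_left]
    intro z h1 h2
    exact hab (h1.symm.trans h2)
  · intro a _
    exact blk_measurable _ (measurableSet_singleton _)

lemma sum_Ub (a0 : A) (m n : ℕ) : ∑ w : Fin (m + n) → A, Ub ν m n (extw a0 w) ≤ 1 := by
  classical
  induction n with
  | zero =>
    rw [← sum_qb ν m]
    refine (Finset.sum_congr rfl fun w _ => ?_).le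
    have hb : blk m (extw a0 w) = w := blk_extw a0 w
    simp [Ub, Qb, hb]
  | succ n ih =>
    refine le_trans ?_ ih
    change ∑ w : Fin ((m + n) + 1) → A, Ub ν m (n + 1) (extw a0 w) ≤ _
    rw [← (Fin.snocEquiv (fun _ : Fin ((m + n) + 1) => A)).sum_comp, Fintype.sum_prod_type,
      Finset.sum_comm]
    refine Finset.sum_le_sum fun w _ => ?_
    set x := extw a0 w with hx
    have hw : ∀ a : A, Ub ν m (n + 1) (extw a0 (Fin.snocEquiv (fun _ : Fin ((m + n) + 1) => A) (a, w)))
        = Ub ν m n x * (Qb ν (m + 1) (Function.update (shB^[n] x) (-(m : ℤ)) a)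
          / Qb ν m (shB^[n] x)) := by
      intro a
      set y := extw a0 (Fin.snocEquiv (fun _ : Fin ((m + n) + 1) => A) (a, w)) with hy
      have h1 : ∀ i : ℕ, i < m + n → y (-(i : ℤ)) = x (-(i : ℤ)) := by
        intro i hi
        have hi' : i < m + n + 1 := by omega
        simp only [hy, hx, extw, neg_neg, Int.toNat_natCast, hi, hi', dite_true]
        simp [Fin.snocEquiv, Fin.snoc, hi]
      have h2 : y (-((m + n : ℕ) : ℤ)) = a := by
        have hi' : m + n < m + n + 1 := by omega
        simp only [hy, extw, neg_neg, Int.toNat_natCast, hi', dite_true]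
        simp [Fin.snocEquiv, Fin.snoc]
      have h3 : Ub ν m (n + 1) y = Ub ν m n y * (Qb ν (m + 1) (shB^[n] y) / Qb ν m (shB^[n] y)) := by
        unfold Ub
        rw [Finset.prod_range_succ, mul_assoc]
      rw [h3, Ub_congr ν ((blk_eq_iff (m + n) y x).2 h1)]
      have h4 : blk m (shB^[n] y) = blk m (shB^[n] x) := by
        rw [blk_eq_iff]
        intro i hi
        rw [shB_iter, shB_iter]
        have := h1 (i + n) (by omega)
        push_cast at this
        rwa [neg_add] at this
      have h5 : blk (m + 1) (shB^[n] y) =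
          blk (m + 1) (Function.update (shB^[n] x) (-(m : ℤ)) a) := by
        rw [blk_eq_iff]
        intro i hi
        rcases Nat.lt_succ_iff_lt_or_eq.1 hi with h | rfl
        · rw [Function.update_of_ne (by omega)]
          exact (blk_eq_iff _ _ _).1 h4 i h
        · rw [Function.update_self, shB_iter]
          push_cast at h2
          rwa [neg_add] at h2
      rw [Qb_congr ν h4, Qb_congr ν h5]
    simp_rw [hw]
    rw [← Finset.mul_sum, ← Finset.sum_div, sum_Qb]
    exact mul_le_of_le_one_right (Ub_nonneg _ _ _ _) (div_self_le_one _)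

lemma lintegral_Ub (m n : ℕ) :
    ∫⁻ x, ENNReal.ofReal (Ub ν m n x / Qb ν (m + n) x) ∂ν ≤ 1 := by
  classical
  obtain ⟨x0⟩ : Nonempty (ℤ → A) := ν.nonempty_of_neZero
  let a0 := x0 0
  let F : (Fin (m + n) → A) → ENNReal := fun w =>
    ENNReal.ofReal (Ub ν m n (extw a0 w) / Qb ν (m + n) (extw a0 w))
  have h1 : ∀ x, ENNReal.ofReal (Ub ν m n x / Qb ν (m + n) x) = F (blk (m + n) x) := by
    intro x
    have hb := blk_extw a0 (blk (m + n) x)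
    simp only [F]
    rw [Ub_congr ν hb, Qb_congr ν hb]
  simp_rw [h1]
  rw [← lintegral_map (measurable_of_finite F) (blk_measurable (m + n)), lintegral_fintype]
  calc ∑ w, F w * (ν.map (blk (m + n))) {w}
      ≤ ∑ w : Fin (m + n) → A, ENNReal.ofReal (Ub ν m n (extw a0 w)) := by
        refine Finset.sum_le_sum fun w _ => ?_
        rw [Measure.map_apply (blk_measurable _) (measurableSet_singleton w)]
        have hq : ν (blk (m + n) ⁻¹' {w}) = ENNReal.ofReal (Qb ν (m + n) (extw a0 w)) := by
          unfold Qb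
          rw [blk_extw, ofReal_measureReal]
        rw [hq, ← ENNReal.ofReal_mul (div_nonneg (Ub_nonneg _ _ _ _) (Qb_nonneg _ _ _))]
        refine ENNReal.ofReal_le_ofReal ?_
        rcases eq_or_ne (Qb ν (m + n) (extw a0 w)) 0 with h0 | h0
        · rw [h0, mul_zero]; exact Ub_nonneg _ _ _ _
        · rw [div_mul_cancel₀ _ h0]
    _ = ENNReal.ofReal (∑ w : Fin (m + n) → A, Ub ν m n (extw a0 w)) :=
        (ENNReal.ofReal_sum_of_nonneg fun w _ => Ub_nonneg _ _ _ _).symm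
    _ ≤ 1 := by
        rw [← ENNReal.ofReal_one]
        exact ENNReal.ofReal_le_ofReal (sum_Ub ν a0 m n)

/-- If weighted expectations are summable, the sequence is almost surely bounded. -/
lemma ae_bdd_of_tsum {α : Type*} [MeasurableSpace α] {ν : Measure α} (f : ℕ → α → ENNReal)
    (hf : ∀ n, AEMeasurable (f n) ν) (h : ∑' n, ∫⁻ x, f n x ∂ν ≠ ⊤) :
    ∀ᵐ x ∂ν, ∑' n, f n x < ⊤ := by
  rw [← lintegral_tsum hf] at h
  exact ae_lt_top' (AEMeasurable.tsum hf) h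

lemma log_Qb_integrable (n : ℕ) : Integrable (fun x => Real.log (Qb ν n x)) ν := by
  have : Integrable (fun w : Fin n → A => Real.log (ν.real (blk n ⁻¹' {w}))) (ν.map (blk n)) := by
    have := Measure.isProbabilityMeasure_map (μ := ν) (blk_measurable (A := A) n).aemeasurable
    exact Integrable.of_finite
  exact this.comp_measurable (blk_measurable n)

lemma smb_lower (hB : Ergodic (shB : (ℤ → A) → ℤ → A) ν) (H c : ℝ) (hc : H < c)
    (hH : Tendsto (fun n : ℕ => (n : ℝ)⁻¹ * (-∫ x, Real.log (Qb ν n x) ∂ν)) atTop (nhds H)) :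
    ∀ᵐ x ∂ν, ∀ᶠ n : ℕ in atTop, Real.exp (-(n * c)) ≤ Qb ν n x := by
  obtain ⟨c1, hc1, hc1c⟩ := exists_between hc
  obtain ⟨c2, hc12, hc2⟩ := exists_between hc1c
  set h : ℕ → ℝ := fun n => -∫ x, Real.log (Qb ν n x) ∂ν with hh
  have hm : ∃ m, h (m + 1) - h m < c1 := by
    by_contra hcon
    push Not at hcon
    have h0 : h 0 = 0 := by simp [hh, Qb_zero]
    have hn : ∀ n : ℕ, n * c1 ≤ h n := by
      intro n
      induction n with
      | zero => simp [h0]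
      | succ n ih => push_cast; linarith [hcon n]
    have : c1 ≤ H := by
      refine ge_of_tendsto hH ?_
      filter_upwards [eventually_gt_atTop 0] with n hn0
      have : (0 : ℝ) < n := by exact_mod_cast hn0
      rw [inv_mul_eq_div, le_div_iff₀ this]
      linarith [hn n]
    linarith
  obtain ⟨m, hm⟩ := hm
  set g : (ℤ → A) → ℝ := fun x => Real.log (Qb ν m x) - Real.log (Qb ν (m + 1) x) - c1 with hg
  have hgm : Measurable g :=
    (((Qb_measurable ν m).log).sub ((Qb_measurable ν (m + 1)).log)).sub_const _
  have hgi : Integrable g ν :=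
    ((log_Qb_integrable ν m).sub (log_Qb_integrable ν (m + 1))).sub (integrable_const _)
  have hneg : ∫ x, g x ∂ν < 0 := by
    have e1 : ∫ x, g x ∂ν = (∫ x, Real.log (Qb ν m x) ∂ν) - (∫ x, Real.log (Qb ν (m + 1) x) ∂ν)
        - c1 := by
      simp only [hg]
      rw [integral_sub _ (integrable_const _), integral_sub (log_Qb_integrable ν m)
        (log_Qb_integrable ν (m + 1))]
      · simp
      · exact (log_Qb_integrable ν m).sub (log_Qb_integrable ν (m + 1))
    rw [e1]
    simp only [hh] at hm
    linarith
  have hbir := ergo_bdd hB g hgm hgi hneg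
  have hUm : ∀ n, Measurable (Ub ν m n) := fun n =>
    (Qb_measurable ν m).mul (Finset.measurable_prod _ fun j _ =>
      ((Qb_measurable ν (m + 1)).comp (hB.measurable.iterate j)).div
        ((Qb_measurable ν m).comp (hB.measurable.iterate j)))
  have hδ : 0 < c2 - c1 := by linarith
  have hbc := ae_bdd_of_tsum (ν := ν)
    (fun n x => ENNReal.ofReal (Real.exp (-(c2 - c1)) ^ n) *
      ENNReal.ofReal (Ub ν m n x / Qb ν (m + n) x))
    (fun n => (((hUm n).div (Qb_measurable ν (m + n))).ennreal_ofReal.const_mul _).aemeasurable)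
    (by
      have hs : Summable fun n : ℕ => Real.exp (-(c2 - c1)) ^ n :=
        summable_geometric_of_lt_one (Real.exp_pos _).le (Real.exp_lt_one_iff.2 (by linarith))
      refine ne_top_of_le_ne_top hs.tsum_ofReal_ne_top ?_
      refine ENNReal.tsum_le_tsum fun n => ?_
      rw [lintegral_const_mul' _ _ ENNReal.ofReal_ne_top]
      exact mul_le_of_le_one_right' (lintegral_Ub ν m n))
  have hpos : ∀ᵐ x ∂ν, ∀ j : ℕ, ∀ n, 0 < Qb ν n (shB^[j] x) := by
    rw [ae_all_iff]
    intro j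
    exact (hB.toMeasurePreserving.iterate j).quasiMeasurePreserving.ae (Qb_pos ν)
  filter_upwards [hbir, hbc, hpos] with x ⟨K, hK⟩ hV hp
  set V := ∑' n, ENNReal.ofReal (Real.exp (-(c2 - c1)) ^ n) *
      ENNReal.ofReal (Ub ν m n x / Qb ν (m + n) x) with hVdef
  -- explicit formula for the Markov approximation
  have hUe : ∀ n : ℕ, Qb ν m x * Real.exp (-(n * c1) - K) ≤ Ub ν m n x := by
    intro n
    unfold Ub
    refine mul_le_mul_of_nonneg_left ?_ (Qb_nonneg _ _ _)
    have : ∏ j ∈ Finset.range n, (Qb ν (m + 1) (shB^[j] x) / Qb ν m (shB^[j] x))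
        = Real.exp (-(n * c1) - ∑ j ∈ Finset.range n, g (shB^[j] x)) := by
      have : (-(n * c1) - ∑ j ∈ Finset.range n, g (shB^[j] x))
          = ∑ j ∈ Finset.range n, (- c1 - g (shB^[j] x)) := by
        simp [hg]
      rw [this, Real.exp_sum]
      refine Finset.prod_congr rfl fun j _ => ?_
      simp only [hg]
      rw [show -c1 - (Real.log (Qb ν m (shB^[j] x)) - Real.log (Qb ν (m + 1) (shB^[j] x)) - c1)
        = Real.log (Qb ν (m + 1) (shB^[j] x)) - Real.log (Qb ν m (shB^[j] x)) by ring,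
        Real.exp_sub, Real.exp_log (hp j _), Real.exp_log (hp j _)]
    rw [this]
    exact Real.exp_le_exp.2 (by linarith [hK n])
  have hVn : ∀ n : ℕ, Real.exp (-(c2 - c1)) ^ n * (Ub ν m n x / Qb ν (m + n) x) ≤ V.toReal := by
    intro n
    have h1 : ENNReal.ofReal (Real.exp (-(c2 - c1)) ^ n) *
      ENNReal.ofReal (Ub ν m n x / Qb ν (m + n) x) ≤ V := ENNReal.le_tsum n
    rw [← ENNReal.ofReal_mul (by positivity)] at h1
    exact (ENNReal.ofReal_le_iff_le_toReal hV.ne).1 h1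
  have hq0 : ∀ n, 0 < Qb ν n x := hp 0
  have hfin : ∀ n : ℕ, Qb ν m x * Real.exp (-K) * Real.exp (-(n * c2)) ≤
      V.toReal * Qb ν (m + n) x := by
    intro n
    have h1 := hVn n
    rw [← mul_div_assoc, div_le_iff₀ (hq0 _)] at h1
    refine le_trans ?_ h1
    calc Qb ν m x * Real.exp (-K) * Real.exp (-(n * c2))
        = Real.exp (-(c2 - c1)) ^ n * (Qb ν m x * Real.exp (-(n * c1) - K)) := by
          rw [← Real.exp_nat_mul, mul_assoc, ← Real.exp_add, mul_left_comm, ← Real.exp_add]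
          congr 2; ring
      _ ≤ _ := by gcongr; exact hUe n
  -- conclude
  have hlim : Tendsto (fun n : ℕ => (V.toReal * Real.exp (-(m * c))) * Real.exp (-(c - c2)) ^ n)
      atTop (nhds 0) := by
    have := (tendsto_pow_atTop_nhds_zero_of_lt_one (Real.exp_pos (-(c - c2))).le
      (Real.exp_lt_one_iff.2 (by linarith))).const_mul (V.toReal * Real.exp (-(m * c)))
    simpa using this
  have hcpos : 0 < Qb ν m x * Real.exp (-K) := mul_pos (hq0 _) (Real.exp_pos _)
  have hev := hlim.eventually (gt_mem_nhds hcpos)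
  have hev2 : ∀ᶠ n : ℕ in atTop, Real.exp (-((m + n : ℕ) * c)) ≤ Qb ν (m + n) x := by
    filter_upwards [hev] with n hn
    have h1 := hfin n
    have hVpos : 0 < V.toReal := by
      have : 0 < V.toReal * Qb ν (m + n) x := lt_of_lt_of_le (by positivity) h1
      exact pos_of_mul_pos_left this (hq0 _).le
    have h2 : V.toReal * Real.exp (-((m + n : ℕ) * c)) ≤ V.toReal * Qb ν (m + n) x := by
      refine le_trans ?_ h1
      have : V.toReal * Real.exp (-((m + n : ℕ) * c))
          = (V.toReal * Real.exp (-(m * c))) * Real.exp (-(c - c2)) ^ n * Real.exp (-(n * c2)) := by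
        rw [← Real.exp_nat_mul, mul_assoc, mul_assoc, ← Real.exp_add, ← Real.exp_add]
        congr 2; push_cast; ring
      rw [this]
      exact mul_le_mul_of_nonneg_right hn.le (Real.exp_pos _).le
    exact le_of_mul_le_mul_left h2 hVpos
  rw [eventually_atTop] at hev2 ⊢
  obtain ⟨N, hN⟩ := hev2
  refine ⟨m + N, fun n hn => ?_⟩
  have := hN (n - m) (by omega)
  rwa [Nat.add_sub_cancel' (by omega)] at this

end pb

set_option linter.unusedSectionVars false

/-- The path seen from the `k`-th stopping time. -/
def xs {A : Type*} (l : ℕ → ℕ) : ℕ → (ℤ → A) → (ℤ → A)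
  | 0, x => x
  | k + 1, x => shF^[ret shF (blk (l (k + 1))) (xs l k x)] (xs l k x)

/-- The stopping times on path space. -/
def zt {A : Type*} (l : ℕ → ℕ) (x : ℤ → A) (k : ℕ) : ℕ :=
  ∑ j ∈ Finset.range k, ret shF (blk (l (j + 1))) (xs l j x)

lemma blk_mono {A : Type*} {m n : ℕ} (h : m ≤ n) {x y : ℤ → A} (hxy : blk n x = blk n y) :
    blk m x = blk m y := by
  rw [blk_eq_iff] at hxy ⊢
  intro i hi
  exact hxy i (by omega)

lemma blk_xs {A : Type*} {l : ℕ → ℕ} (hl : Monotone l) (x : ℤ → A) {n j k : ℕ} (hn : n ≤ l (j + 1))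
    (hjk : j ≤ k) : blk n (xs l k x) = blk n (xs l j x) := by
  induction k, hjk using Nat.le_induction with
  | base => rfl
  | succ k hk ih =>
    rw [← ih]
    refine blk_mono (hn.trans (hl (by omega : j + 1 ≤ k + 1))) ?_
    exact ret_label shF (blk (l (k + 1))) (xs l k x)

section pc
variable {A : Type*} [MeasurableSpace A] [Fintype A] [MeasurableSingletonClass A]
  {ν : Measure (ℤ → A)} [IsProbabilityMeasure ν]

lemma shB_shF {A : Type*} : Function.LeftInverse (shB : (ℤ → A) → ℤ → A) shF := by
  intro x; ext n; simp [shB, shF]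

lemma shF_shB {A : Type*} : Function.LeftInverse (shF : (ℤ → A) → ℤ → A) shB := by
  intro x; ext n; simp [shB, shF]

lemma shB_meas : Measurable (shB : (ℤ → A) → ℤ → A) :=
  measurable_pi_lambda _ fun _ => measurable_pi_apply _

lemma shB_ergodic (hF : Ergodic (shF : (ℤ → A) → ℤ → A) ν) :
    Ergodic (shB : (ℤ → A) → ℤ → A) ν := by
  have hmp : MeasurePreserving (shB : (ℤ → A) → ℤ → A) ν ν := by
    refine ⟨shB_meas, ?_⟩
    conv_lhs => rw [← hF.map_eq]
    rw [Measure.map_map shB_meas hF.measurable, shB_shF.comp_eq_id, Measure.map_id]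
  refine ⟨hmp, ⟨fun s hs hinv => hF.toPreErgodic.aeconst_set hs ?_⟩⟩
  conv_lhs => rw [← hinv]
  rw [← Set.preimage_comp, shB_shF.comp_eq_id, Set.preimage_id]

lemma xs_mp (hF : Ergodic (shF : (ℤ → A) → ℤ → A) ν) (l : ℕ → ℕ) (k : ℕ) :
    MeasurePreserving (xs l k) ν ν := by
  induction k with
  | zero => exact MeasurePreserving.id ν
  | succ k ih =>
    exact (ret_measurePreserving hF.toMeasurePreserving (shB_ergodic hF).toMeasurePreserving
      shB_shF (blk_measurable (l (k + 1)))).comp ih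

lemma good_xs (hF : Ergodic (shF : (ℤ → A) → ℤ → A) ν) {l : ℕ → ℕ} (hl : Monotone l)
    (b : ℕ → ℝ) (h : ∀ᵐ x ∂ν, ∀ᶠ k : ℕ in atTop, b k ≤ Qb ν (l k) x) :
    ∀ᵐ x ∂ν, ∀ᶠ k : ℕ in atTop, b k ≤ Qb ν (l k) (xs l k x) := by
  let P : ℕ → Set (ℤ → A) := fun k => {x | Qb ν (l k) x < b k}
  have hP : ∀ k, MeasurableSet (P k) := fun k =>
    measurableSet_lt (Qb_measurable ν (l k)) measurable_const
  have hcongr : ∀ k K x, k ≤ K → (xs l k x ∈ P k ↔ xs l K x ∈ P k) := by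
    intro k K x hk
    simp only [P, Set.mem_ofPred_eq]
    rw [Qb_congr ν (blk_xs hl x (n := l k) (hl (by omega)) hk)]
  let G : ℕ → Set (ℤ → A) := fun K => ⋃ k, ⋃ (_ : K ≤ k), P k
  have hG : ∀ K, MeasurableSet (G K) := fun K =>
    MeasurableSet.iUnion fun k => MeasurableSet.iUnion fun _ => hP k
  have hGanti : Antitone G := by
    intro K K' hK x hx
    simp only [G, Set.mem_iUnion] at hx ⊢
    obtain ⟨k, hk, hx⟩ := hx
    exact ⟨k, hK.trans hk, hx⟩
  have hG0 : ν (⋂ K, G K) = 0 := by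
    rw [ae_iff] at h
    refine measure_mono_null ?_ h
    intro x hx
    simp only [G, P, Set.mem_iInter, Set.mem_iUnion, Set.mem_ofPred_eq] at hx ⊢
    intro hev
    obtain ⟨K, hK⟩ := eventually_atTop.1 hev
    obtain ⟨k, hk, hx⟩ := hx K
    exact absurd (hK k hk) (not_le.2 hx)
  have hGlim : Tendsto (fun K => ν (G K)) atTop (nhds 0) := by
    rw [← hG0]
    exact tendsto_measure_iInter_atTop (fun K => (hG K).nullMeasurableSet) hGanti
      ⟨0, measure_ne_top _ _⟩
  have hle : ∀ K, ν (⋃ k, ⋃ (_ : K ≤ k), xs l k ⁻¹' P k) ≤ ν (G K) := by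
    intro K
    let D : ℕ → Set (ℤ → A) := fun K' => ⋃ k, ⋃ (_ : K ≤ k ∧ k ≤ K'), xs l k ⁻¹' P k
    have hD : (⋃ k, ⋃ (_ : K ≤ k), xs l k ⁻¹' P k) = ⋃ K', D K' := by
      ext x
      simp only [D, Set.mem_iUnion]
      constructor
      · rintro ⟨k, hk, hx⟩; exact ⟨k, k, ⟨hk, le_rfl⟩, hx⟩
      · rintro ⟨K', k, ⟨hk, _⟩, hx⟩; exact ⟨k, hk, hx⟩
    have hDm : Monotone D := by
      intro K1 K2 h12 x hx
      simp only [D, Set.mem_iUnion] at hx ⊢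
      obtain ⟨k, ⟨hk1, hk2⟩, hx⟩ := hx
      exact ⟨k, ⟨hk1, hk2.trans h12⟩, hx⟩
    rw [hD, hDm.measure_iUnion]
    refine iSup_le fun K' => ?_
    rw [← (xs_mp hF l K').measure_preimage (hG K).nullMeasurableSet]
    refine measure_mono ?_
    intro x hx
    simp only [D, G, Set.mem_iUnion, Set.mem_preimage] at hx ⊢
    obtain ⟨k, ⟨hk1, hk2⟩, hx⟩ := hx
    exact ⟨k, hk1, (hcongr k K' x hk2).1 hx⟩
  rw [ae_iff]
  refine le_antisymm (ge_of_tendsto' hGlim fun K => (measure_mono ?_).trans (hle K)) bot_le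
  intro x hx
  simp only [Set.mem_ofPred_eq, not_eventually, not_le] at hx
  obtain ⟨k, hk, hx⟩ := frequently_atTop.1 hx K
  simp only [Set.mem_iUnion]
  exact ⟨k, hk, hx⟩

lemma weighted_bdd (hF : Ergodic (shF : (ℤ → A) → ℤ → A) ν) {l : ℕ → ℕ} (hl : Monotone l)
    (w : ℕ → ℝ) (hw0 : ∀ k, 0 ≤ w k) (hw : Antitone w) (hws : Summable w) :
    ∀ᵐ x ∂ν, ∃ V : ℝ, ∀ k, w k * Qb ν (l k) (xs l k x) * zt l x k ≤ V := by
  let F : ℕ → (ℤ → A) → ENNReal := fun j y =>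
    (ret shF (blk (l (j + 1))) y : ENNReal) * ν (blk (l (j + 1)) ⁻¹' {blk (l (j + 1)) y})
  have hFm : ∀ j, Measurable (F j) := by
    intro j
    refine Measurable.mul ?_ ?_
    · exact (measurable_of_countable (fun n : ℕ => (n : ENNReal))).comp
        (ret_measurable hF.measurable (blk_measurable _))
    · exact (measurable_of_finite
        (fun v : Fin (l (j + 1)) → A => ν (blk (l (j + 1)) ⁻¹' {v}))).comp (blk_measurable _)
  have hb := ae_bdd_of_tsum (ν := ν) (fun j x => ENNReal.ofReal (w (j + 1)) * F j (xs l j x))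
    (fun j => (((hFm j).comp (xs_mp hF l j).measurable).const_mul _).aemeasurable)
    (by
      refine ne_top_of_le_ne_top ((summable_nat_add_iff 1).2 hws).tsum_ofReal_ne_top ?_
      refine ENNReal.tsum_le_tsum fun j => ?_
      rw [lintegral_const_mul' _ _ ENNReal.ofReal_ne_top, (xs_mp hF l j).lintegral_comp (hFm j)]
      exact mul_le_of_le_one_right' (kac_weighted hF.toMeasurePreserving
        (shB_ergodic hF).toMeasurePreserving shB_shF (blk_measurable _)))
  filter_upwards [hb] with x hx
  set V := ∑' j, ENNReal.ofReal (w (j + 1)) * F j (xs l j x) with hV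
  refine ⟨V.toReal, fun k => ?_⟩
  have hterm : ∀ j, ENNReal.ofReal (w (j + 1)) * F j (xs l j x) = ENNReal.ofReal
      (w (j + 1) * (ret shF (blk (l (j + 1))) (xs l j x) * Qb ν (l (j + 1)) (xs l j x))) := by
    intro j
    rw [ENNReal.ofReal_mul (hw0 _), ENNReal.ofReal_mul (Nat.cast_nonneg _)]
    simp only [F, Qb, ENNReal.ofReal_natCast]
    rw [ofReal_measureReal]
  have h1 : ENNReal.ofReal (∑ j ∈ Finset.range k,
      w (j + 1) * (ret shF (blk (l (j + 1))) (xs l j x) * Qb ν (l (j + 1)) (xs l j x))) ≤ V := by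
    rw [ENNReal.ofReal_sum_of_nonneg]
    · simp_rw [← hterm]
      exact ENNReal.sum_le_tsum _
    · intro j _
      exact mul_nonneg (hw0 _) (mul_nonneg (Nat.cast_nonneg _) (Qb_nonneg _ _ _))
  have h2 := (ENNReal.ofReal_le_iff_le_toReal hx.ne).1 h1
  refine le_trans ?_ h2
  unfold zt
  push_cast
  rw [Finset.mul_sum]
  refine Finset.sum_le_sum fun j hj => ?_
  rw [Finset.mem_range] at hj
  have e1 : Qb ν (l k) (xs l k x) ≤ Qb ν (l (j + 1)) (xs l j x) := by
    rw [← Qb_congr ν (blk_xs hl x (n := l (j + 1)) le_rfl hj.le)]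
    exact Qb_anti ν (hl hj) _
  have e2 : w k ≤ w (j + 1) := hw hj
  calc w k * Qb ν (l k) (xs l k x) * (ret shF (blk (l (j + 1))) (xs l j x) : ℝ)
      ≤ w (j + 1) * Qb ν (l (j + 1)) (xs l j x) * (ret shF (blk (l (j + 1))) (xs l j x) : ℝ) := by
        have := Qb_nonneg ν (l k) (xs l k x)
        have := hw0 (j + 1)
        gcongr
    _ = _ := by ring

end pc

lemma weights_summable (l : ℕ → ℕ) (hlmono : Monotone l) (ε : ℝ) (hε : 0 < ε)
    (hsum : Summable (fun k : ℕ => ((k : ℝ) + 1) * (2 : ℝ) ^ (-((l k : ℝ) * ε)))) :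
    Summable (fun k : ℕ => (2 : ℝ) ^ (-((l k : ℝ) * (2 / 3 * ε)))) := by
  set S := ∑' k : ℕ, ((k : ℝ) + 1) * (2 : ℝ) ^ (-((l k : ℝ) * ε)) with hS
  have hb : ∀ k : ℕ, 0 < k → (2 : ℝ) ^ (-((l k : ℝ) * ε)) ≤ 2 * S * ((k : ℝ) ^ (2 : ℝ))⁻¹ := by
    intro k hk
    have h1 : ∑ j ∈ Finset.range k, ((j : ℝ) + 1) * (2 : ℝ) ^ (-((l j : ℝ) * ε)) ≤ S :=
      hsum.sum_le_tsum _ fun j _ => by positivity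
    have h2 : ∑ j ∈ Finset.range k, ((j : ℝ) + 1) * (2 : ℝ) ^ (-((l k : ℝ) * ε)) ≤ S := by
      refine le_trans (Finset.sum_le_sum fun j hj => ?_) h1
      rw [Finset.mem_range] at hj
      have : (l j : ℝ) ≤ l k := by exact_mod_cast hlmono hj.le
      gcongr
      norm_num
    have h3 : (k : ℝ) ^ 2 / 2 ≤ ∑ j ∈ Finset.range k, ((j : ℝ) + 1) := by
      clear h1 h2 hk
      induction k with
      | zero => simp
      | succ k ih => rw [Finset.sum_range_succ]; push_cast; nlinarith
    rw [← Finset.sum_mul] at h2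
    have hk' : (0 : ℝ) < (k : ℝ) ^ 2 := by positivity
    have h4 : (k : ℝ) ^ 2 / 2 * (2 : ℝ) ^ (-((l k : ℝ) * ε)) ≤ S :=
      le_trans (by gcongr) h2
    rw [Real.rpow_two, ← div_eq_mul_inv, le_div_iff₀ hk']
    linarith
  have hS0 : 0 ≤ S := tsum_nonneg fun k => by positivity
  refine Summable.of_norm_bounded_eventually_nat (g := fun k : ℕ => (2 * S) ^ (2 / 3 : ℝ) *
    ((k : ℝ) ^ (4 / 3 : ℝ))⁻¹) ?_ ?_
  · exact ((Real.summable_nat_rpow_inv (p := 4 / 3)).2 (by norm_num)).mul_left _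
  · filter_upwards [eventually_gt_atTop 0] with k hk
    rw [Real.norm_of_nonneg (by positivity)]
    have h1 := Real.rpow_le_rpow (by positivity) (hb k hk) (show (0 : ℝ) ≤ 2 / 3 by norm_num)
    rw [← Real.rpow_mul (by norm_num), Real.mul_rpow (by positivity) (by positivity),
      Real.inv_rpow (by positivity), ← Real.rpow_mul (by positivity)] at h1
    convert h1 using 2
    · ring
    · norm_num

lemma core {A : Type*} [MeasurableSpace A] [Fintype A] [MeasurableSingletonClass A]
    {ν : Measure (ℤ → A)} [IsProbabilityMeasure ν]
    (hF : Ergodic (shF : (ℤ → A) → ℤ → A) ν) (H : ℝ)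
    (hH : Tendsto (fun n : ℕ => (n : ℝ)⁻¹ * (-∫ x, Real.log (Qb ν n x) ∂ν)) atTop
      (nhds (H * Real.log 2)))
    (l : ℕ → ℕ) (hlmono : Monotone l) (hltop : Tendsto l atTop atTop)
    (ε : ℝ) (hε : 0 < ε)
    (hsum : Summable (fun k : ℕ => ((k : ℝ) + 1) * (2 : ℝ) ^ (-((l k : ℝ) * ε)))) :
    ∀ᵐ x ∂ν, ∀ᶠ k in atTop, (zt l x k : ℝ) < (2 : ℝ) ^ ((l k : ℝ) * (H + ε)) := by
  have hlog : 0 < Real.log 2 := Real.log_pos (by norm_num)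
  have h1 := smb_lower ν (shB_ergodic hF) (H * Real.log 2) ((H + ε / 4) * Real.log 2)
    (by nlinarith) hH
  have h2 : ∀ᵐ x ∂ν, ∀ᶠ k : ℕ in atTop, (2 : ℝ) ^ (-((l k : ℝ) * (H + ε / 4))) ≤ Qb ν (l k) x := by
    filter_upwards [h1] with x hx
    filter_upwards [hltop.eventually hx] with k hk
    rw [Real.rpow_def_of_pos (by norm_num)]
    convert hk using 2
    ring
  have h3 := good_xs hF hlmono _ h2
  have h4 := weighted_bdd hF hlmono (fun k => (2 : ℝ) ^ (-((l k : ℝ) * (2 / 3 * ε))))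
    (fun k => by positivity)
    (by
      intro i j hij
      have : (l i : ℝ) ≤ l j := by exact_mod_cast hlmono hij
      simp only
      gcongr
      norm_num)
    (weights_summable l hlmono ε hε hsum)
  filter_upwards [h3, h4] with x hx ⟨V, hV⟩
  have hlim : Tendsto (fun k => (2 : ℝ) ^ ((l k : ℝ) * (ε / 12))) atTop atTop := by
    have e : ∀ k, (2 : ℝ) ^ ((l k : ℝ) * (ε / 12)) = Real.exp (Real.log 2 * (ε / 12) * l k) := by
      intro k
      rw [Real.rpow_def_of_pos (by norm_num)]; congr 1; ring
    simp_rw [e]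
    exact Real.tendsto_exp_atTop.comp
      ((tendsto_natCast_atTop_atTop.comp hltop).const_mul_atTop (by positivity))
  filter_upwards [hx, hlim.eventually_gt_atTop V] with k hk hkV
  have hVk := hV k
  have e1 : (2 : ℝ) ^ (-((l k : ℝ) * (2 / 3 * ε))) * (2 : ℝ) ^ (-((l k : ℝ) * (H + ε / 4)))
      * zt l x k ≤ V := by
    refine le_trans ?_ hVk
    gcongr
  have e2 : (2 : ℝ) ^ (-((l k : ℝ) * (2 / 3 * ε))) * (2 : ℝ) ^ (-((l k : ℝ) * (H + ε / 4)))
      * (2 : ℝ) ^ ((l k : ℝ) * (H + ε)) = (2 : ℝ) ^ ((l k : ℝ) * (ε / 12)) := by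
    rw [← Real.rpow_add (by norm_num), ← Real.rpow_add (by norm_num)]
    congr 1; ring
  have e3 := lt_of_le_of_lt e1 (hkV.trans_eq e2.symm)
  exact lt_of_mul_lt_mul_left e3 (by positivity)

lemma int_log {A : Type*} [MeasurableSpace A] [Fintype A] [MeasurableSingletonClass A]
    (ν : Measure (ℤ → A)) [IsProbabilityMeasure ν] (n : ℕ) :
    ∫ x, Real.log (Qb ν n x) ∂ν = ∑ w : Fin n → A, ν.real (blk n ⁻¹' {w}) *
      Real.log (ν.real (blk n ⁻¹' {w})) := by
  have hp := Measure.isProbabilityMeasure_map (μ := ν) (blk_measurable (A := A) n).aemeasurable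
  have h := integral_map (μ := ν) (blk_measurable (A := A) n).aemeasurable
    (f := fun w => Real.log (ν.real (blk n ⁻¹' {w})))
    (measurable_of_finite _).aestronglyMeasurable
  change ∫ x, (fun w => Real.log (ν.real (blk n ⁻¹' {w}))) (blk n x) ∂ν = _
  rw [← h, integral_fintype Integrable.of_finite]
  refine Finset.sum_congr rfl fun w _ => ?_
  rw [map_measureReal_apply (blk_measurable n) (measurableSet_singleton w), smul_eq_mul]

lemma recEtaA_eq [DecidableEq A] (l : ℕ → ℕ) (X : ℤ → Ω → A) (k : ℕ) (b : ℤ) (ω : Ω) :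
    recEtaA l X k b ω = ret shF (blk (l k)) (fun n => X (n + b) ω) := by
  unfold recEtaA ret
  congr 1
  ext t
  simp only [Set.mem_ofPred_eq, blk_eq_iff, shF_iter]
  refine and_congr_right fun _ => forall_congr' fun i => imp_congr_right fun _ => ?_
  rw [show b + t - i = -(i : ℤ) + t + b by ring, show b - i = -(i : ℤ) + b by ring]

lemma recZetaA_eq [DecidableEq A] (l : ℕ → ℕ) (X : ℤ → Ω → A) (k : ℕ) (ω : Ω) :
    recZetaA l X k ω = zt l (fun n => X n ω) k ∧
      xs l k (fun n => X n ω) = fun n => X (n + recZetaA l X k ω) ω := by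
  induction k with
  | zero => simp [recZetaA, zt, xs]
  | succ k ih =>
    obtain ⟨h1, h2⟩ := ih
    have h3 : recZetaA l X (k + 1) ω = recZetaA l X k ω +
        (ret shF (blk (l (k + 1))) (xs l k (fun n => X n ω)) : ℕ) := by
      rw [h2, ← recEtaA_eq]; rfl
    constructor
    · rw [h3, h1]
      unfold zt
      rw [Finset.sum_range_succ]
      push_cast
      rfl
    · rw [h3]
      simp only [xs]
      ext n
      rw [shF_iter]
      conv_lhs => rw [h2]
      simp only
      congr 1
      rw [h2]
      ring

/-- For a stationary ergodic finite alphabet process with entropy rate `H`, if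
`∑ (k+1) 2^{-l_k ε} < ∞` then `ζ_k < 2^{l_k (H + ε)}` eventually almost surely. -/
theorem finite_alphabet_stopping_time_growth
    [MeasurableSpace Ω] (μ : Measure Ω) [IsProbabilityMeasure μ]
    [Fintype A] [DecidableEq A] [MeasurableSpace A] [MeasurableSingletonClass A]
    (X : ℤ → Ω → A) (hXmeas : ∀ n, Measurable (X n))
    (hergo : Ergodic (fun x : ℤ → A => fun n => x (n + 1))
      (Measure.map (fun ω => fun n : ℤ => X n ω) μ))
    (H : ℝ)
    (hH : Filter.Tendsto
      (fun n : ℕ => (n : ℝ)⁻¹ *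
        (- ∑ y : Fin n → A,
          (μ {ω | ∀ i : Fin n, X ((i : ℕ) + 1) ω = y i}).toReal *
            Real.logb 2 (μ {ω | ∀ i : Fin n, X ((i : ℕ) + 1) ω = y i}).toReal))
      Filter.atTop (nhds H))
    (l : ℕ → ℕ) (hlmono : Monotone l) (hlpos : ∀ k, 1 ≤ l k)
    (hlle : ∀ k, 1 ≤ k → l k ≤ k) (hltop : Filter.Tendsto l Filter.atTop Filter.atTop)
    (ε : ℝ) (hε : 0 < ε)
    (hsum : Summable (fun k : ℕ => ((k : ℝ) + 1) * (2 : ℝ) ^ (-((l k : ℝ) * ε)))) :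
    ∀ᵐ ω ∂μ, ∀ᶠ k in Filter.atTop,
      ((recZetaA l X k ω : ℝ)) < (2 : ℝ) ^ ((l k : ℝ) * (H + ε)) := by
  classical
  set Z : Ω → ℤ → A := fun ω => fun n : ℤ => X n ω with hZ
  have hZm : Measurable Z := measurable_pi_lambda _ hXmeas
  set ν := Measure.map Z μ with hν
  have hprob : IsProbabilityMeasure ν := Measure.isProbabilityMeasure_map hZm.aemeasurable
  have hF : Ergodic (shF : (ℤ → A) → ℤ → A) ν := hergo
  have hlog : 0 < Real.log 2 := Real.log_pos (by norm_num)
  have hp : ∀ (n : ℕ) (y : Fin n → A),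
      (μ {ω | ∀ i : Fin n, X ((i : ℕ) + 1) ω = y i}).toReal =
        ν.real (blk n ⁻¹' {fun i => y (Fin.rev i)}) := by
    intro n y
    have hms : MeasurableSet (blk n ⁻¹' {fun i => y (Fin.rev i)}) :=
      blk_measurable n (measurableSet_singleton _)
    have e1 : ν (blk n ⁻¹' {fun i => y (Fin.rev i)}) =
        ν (shF^[n] ⁻¹' (blk n ⁻¹' {fun i => y (Fin.rev i)})) :=
      ((hF.toMeasurePreserving.iterate n).measure_preimage hms.nullMeasurableSet).symm
    unfold Measure.real
    rw [e1, hν, Measure.map_apply hZm ((hF.measurable.iterate n) hms)]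
    congr 2
    ext ω
    simp only [Set.mem_ofPred_eq, Set.mem_preimage, Set.mem_singleton_iff, funext_iff]
    rw [← (Fin.revPerm (n := n)).forall_congr_right]
    refine forall_congr' fun i => ?_
    simp only [Fin.revPerm_apply, blk, shF_iter, hZ]
    have : ((Fin.rev i : ℕ) : ℤ) + 1 = -(i : ℤ) + n := by
      rw [Fin.val_rev]; omega
    rw [this]
  have hH' : Tendsto (fun n : ℕ => (n : ℝ)⁻¹ * (-∫ x, Real.log (Qb ν n x) ∂ν)) atTop
      (nhds (H * Real.log 2)) := by
    refine (hH.mul_const (Real.log 2)).congr fun n => ?_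
    rw [mul_assoc]
    congr 1
    rw [neg_mul, int_log, Finset.sum_mul]
    congr 1
    simp_rw [hp]
    rw [← ((Fin.revPerm (n := n)).arrowCongr (Equiv.refl A)).sum_comp]
    refine Finset.sum_congr rfl fun y _ => ?_
    have : ((Fin.revPerm (n := n)).arrowCongr (Equiv.refl A)) y = fun i => y (Fin.rev i) := by
      ext i; simp [Equiv.arrowCongr]
    rw [this]
    simp only [Fin.rev_rev, Real.logb]
    field_simp
  have hc := ae_of_ae_map hZm.aemeasurable
    (core hF H hH' l hlmono hltop ε hε hsum)
  filter_upwards [hc] with ω hω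
  filter_upwards [hω] with k hk
  rw [(recZetaA_eq l X k ω).1]
  exact_mod_cast hk

end
end
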